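/- Let G be a discrete group and let Λ₁, Λ₂ ⊆ G be completely Sidon sets with constants C₁ and C₂ respectively. Then for every real ε with 0 < ε < 1, the union Λ₁ ∪ Λ₂ is a completely Sidon set with constant (C₁⁴ + C₂⁴)/(ε(1−ε)). In particular, the union of two completely Sidon sets is completely Sidon. -/

import Mathlib

/-- The operator `Op(a,v)` on the ℓ²-direct sum of `N` copies of `H`. -/
noncomputable def sidonOp {G : Type} {Λ : Set G} {N : ℕ}
    (a : ↥Λ →₀ Matrix (Fin N) (Fin N) ℂ)
    {H : Type} [NormedAddCommGroup H] [InnerProductSpace ℂ H]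
    (v : ↥Λ → H →L[ℂ] H) :
    PiLp 2 (fun _ : Fin N => H) →L[ℂ] PiLp 2 (fun _ : Fin N => H) :=
  (((PiLp.continuousLinearEquiv 2 ℂ (fun _ : Fin N => H)).symm :
      (Fin N → H) →L[ℂ] PiLp 2 (fun _ : Fin N => H)).comp
    ((ContinuousLinearMap.pi fun i =>
        ∑ t ∈ a.support, ∑ j, (a t i j) • ((v t).comp (ContinuousLinearMap.proj j))).comp
      (((PiLp.continuousLinearEquiv 2 ℂ (fun _ : Fin N => H)) :
        PiLp 2 (fun _ : Fin N => H) →L[ℂ] (Fin N → H)))))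

/-- `Λ ⊆ G` is completely Sidon with constant `C`. -/
def IsCompletelySidon {G : Type} [Group G] (Λ : Set G) (C : ℝ) : Prop :=
  ∀ (N : ℕ) (a : ↥Λ →₀ Matrix (Fin N) (Fin N) ℂ) (D : ℝ), 0 ≤ D →
    (∀ (H' : Type) [NormedAddCommGroup H'] [InnerProductSpace ℂ H'] [CompleteSpace H']
        (π : G →* unitary (H' →L[ℂ] H')),
        ‖sidonOp a (fun t => ((π (t : G) : unitary (H' →L[ℂ] H')) : H' →L[ℂ] H'))‖ ≤ D) →
    ∀ (K : Type) [NormedAddCommGroup K] [InnerProductSpace ℂ K] [CompleteSpace K]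
      (u : ↥Λ → unitary (K →L[ℂ] K)),
      ‖sidonOp a (fun t => ((u t : unitary (K →L[ℂ] K)) : K →L[ℂ] K))‖ ≤ C * D


open scoped InnerProductSpace ComplexConjugate ComplexOrder

namespace SidonU

/-- operator form -/
noncomputable def opform {G n H : Type} [Fintype n] [NormedAddCommGroup H] [InnerProductSpace ℂ H]
    (A : G →₀ Matrix n n ℂ) (v : G → H →L[ℂ] H) (ξ η : n → H) : ℂ :=
  A.sum fun t m => ∑ i, ∑ j, m i j * ⟪ξ i, v t (η j)⟫_ℂ

/-- matrix form -/
noncomputable def mform {G n m : Type} [Fintype n] [Fintype m]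
    (A : G →₀ Matrix n n ℂ) (y : G → Matrix m m ℂ) (ξ η : n → m → ℂ) : ℂ :=
  A.sum fun t M => ∑ i, ∑ j, M i j * ∑ a, ∑ b, conj (ξ i a) * y t a b * η j b

/-- contraction with constant -/
def IsContr {m : Type} [Fintype m] (c : ℝ) (x : Matrix m m ℂ) : Prop :=
  ∀ v w : m → ℂ, (∑ a, ∑ b, conj (v a) * x a b * w b).re ≤
    c / 2 * (∑ a, ‖v a‖ ^ 2 + ∑ a, ‖w a‖ ^ 2)

/-- All unitary representations bound. -/
def RepBd {G n : Type} [Group G] [Fintype n] (A : G →₀ Matrix n n ℂ) (D : ℝ) : Prop :=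
  ∀ (H' : Type) [NormedAddCommGroup H'] [InnerProductSpace ℂ H'] [CompleteSpace H']
    (π : G →* unitary (H' →L[ℂ] H')) (ξ η : n → H'),
    (opform A (fun t => (π t : H' →L[ℂ] H')) ξ η).re ≤ D / 2 * (∑ i, ‖ξ i‖ ^ 2 + ∑ i, ‖η i‖ ^ 2)

/-- completely Sidon, matrix version -/
def CSm {G : Type} [Group G] (Λ : Set G) (C : ℝ) : Prop :=
  ∀ (n : Type) [Fintype n] (A : G →₀ Matrix n n ℂ), (∀ t, t ∉ Λ → A t = 0) → ∀ D : ℝ, 0 ≤ D →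
    RepBd A D → ∀ (m : Type) [Fintype m] (y : G → Matrix m m ℂ), (∀ t ∈ Λ, IsContr 1 (y t)) →
    ∀ ξ η : n → m → ℂ, (mform A y ξ η).re ≤
      C * D / 2 * (∑ i, ∑ a, ‖ξ i a‖ ^ 2 + ∑ i, ∑ a, ‖η i a‖ ^ 2)

lemma norm_le_iff_re {E : Type} [NormedAddCommGroup E] [InnerProductSpace ℂ E]
    (T : E →L[ℂ] E) (D : ℝ) (hD : 0 ≤ D) :
    ‖T‖ ≤ D ↔ ∀ ξ η : E, (⟪ξ, T η⟫_ℂ).re ≤ D / 2 * (‖ξ‖ ^ 2 + ‖η‖ ^ 2) := by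
  constructor
  · intro h ξ η
    have h1 : (⟪ξ, T η⟫_ℂ).re ≤ ‖ξ‖ * ‖T η‖ := re_inner_le_norm (𝕜 := ℂ) ξ (T η)
    have h2 : ‖T η‖ ≤ D * ‖η‖ := (T.le_opNorm η).trans (by gcongr)
    nlinarith [norm_nonneg ξ, norm_nonneg η, mul_nonneg hD (sq_nonneg (‖ξ‖ - ‖η‖)),
      mul_le_mul_of_nonneg_left h2 (norm_nonneg ξ)]
  · intro h
    refine T.opNorm_le_bound hD fun η => ?_
    by_cases hη : η = 0
    · simp [hη]
    by_cases hT : T η = 0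
    · rw [hT]; simp; positivity
    have hη' : 0 < ‖η‖ := norm_pos_iff.2 hη
    have hT' : 0 < ‖T η‖ := norm_pos_iff.2 hT
    have := h (((‖η‖ / ‖T η‖ : ℝ) : ℂ) • T η) η
    rw [inner_smul_left, norm_smul] at this
    simp only [inner_self_eq_norm_sq_to_K, Complex.conj_ofReal, Complex.norm_real, norm_div,
      norm_norm] at this
    rw [div_mul_cancel₀ _ hT'.ne'] at this
    norm_cast at this
    have h3 : ‖η‖ / ‖T η‖ * ‖T η‖ ^ 2 = ‖η‖ * ‖T η‖ := by field_simp
    simp only [Complex.coe_algebraMap] at this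
    norm_cast at this
    rw [h3] at this
    nlinarith

lemma inner_sidonOp {G : Type} {Λ : Set G} {N : ℕ}
    (a : ↥Λ →₀ Matrix (Fin N) (Fin N) ℂ)
    {H : Type} [NormedAddCommGroup H] [InnerProductSpace ℂ H]
    (v : ↥Λ → H →L[ℂ] H) (ξ η : PiLp 2 (fun _ : Fin N => H)) :
    ⟪ξ, sidonOp a v η⟫_ℂ = a.sum fun t m => ∑ i, ∑ j, m i j * ⟪ξ i, v t (η j)⟫_ℂ := by
  rw [PiLp.inner_apply, Finsupp.sum, Finset.sum_comm]
  refine Finset.sum_congr rfl fun i _ => ?_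
  have : sidonOp a v η i = ∑ t ∈ a.support, ∑ j, (a t i j) • v t (η j) := by
    simp [sidonOp, ContinuousLinearMap.sum_apply]
  rw [this, inner_sum]
  refine Finset.sum_congr rfl fun t _ => ?_
  rw [inner_sum]
  simp [inner_smul_right]

lemma sidonOp_norm_le_iff {G : Type} {Λ : Set G} {N : ℕ}
    (a : ↥Λ →₀ Matrix (Fin N) (Fin N) ℂ)
    {H : Type} [NormedAddCommGroup H] [InnerProductSpace ℂ H]
    (v : ↥Λ → H →L[ℂ] H) (D : ℝ) (hD : 0 ≤ D) :
    ‖sidonOp a v‖ ≤ D ↔ ∀ ξ η : Fin N → H,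
      (a.sum fun t m => ∑ i, ∑ j, m i j * ⟪ξ i, v t (η j)⟫_ℂ).re ≤
        D / 2 * (∑ i, ‖ξ i‖ ^ 2 + ∑ i, ‖η i‖ ^ 2) := by
  rw [norm_le_iff_re _ _ hD]
  constructor
  · intro h ξ η
    have := h (WithLp.toLp 2 ξ) (WithLp.toLp 2 η)
    rw [inner_sidonOp] at this
    simpa [PiLp.norm_sq_eq_of_L2] using this
  · intro h ξ η
    have := h ξ η
    rw [inner_sidonOp]
    simpa [PiLp.norm_sq_eq_of_L2] using this

end SidonU

open scoped InnerProductSpace ComplexConjugate ComplexOrder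

namespace SidonU

lemma inner_toEuclideanCLM' {m : Type} [Fintype m] [DecidableEq m] (x : Matrix m m ℂ)
    (v w : EuclideanSpace ℂ m) :
    ⟪v, Matrix.toEuclideanCLM (𝕜 := ℂ) x w⟫_ℂ = ∑ a, ∑ b, conj (v a) * x a b * w b := by
  rw [PiLp.inner_apply]
  refine Finset.sum_congr rfl fun a _ => ?_
  rw [Matrix.ofLp_toEuclideanCLM]
  simp only [Matrix.mulVec, dotProduct, RCLike.inner_apply, Finset.sum_mul]
  refine Finset.sum_congr rfl fun b _ => ?_
  ring

lemma isContr_iff {m : Type} [Fintype m] [DecidableEq m] (x : Matrix m m ℂ) (c : ℝ) (hc : 0 ≤ c) :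
    IsContr c x ↔ ‖Matrix.toEuclideanCLM (𝕜 := ℂ) x‖ ≤ c := by
  rw [norm_le_iff_re _ _ hc]
  constructor
  · intro h v w
    rw [inner_toEuclideanCLM']
    simpa [EuclideanSpace.norm_sq_eq] using h v w
  · intro h v w
    have := h (WithLp.toLp 2 v) (WithLp.toLp 2 w)
    rw [inner_toEuclideanCLM'] at this
    simpa [EuclideanSpace.norm_sq_eq] using this

lemma isContr_block {m : Type} [Fintype m] (x : Matrix m m ℂ) (h : IsContr 1 x) :
    IsContr 1 (Matrix.fromBlocks 0 x x.conjTranspose 0) := by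
  intro v w
  simp only [Fintype.sum_sum_type, Matrix.fromBlocks_apply₁₁, Matrix.fromBlocks_apply₁₂,
    Matrix.fromBlocks_apply₂₁, Matrix.fromBlocks_apply₂₂, Matrix.zero_apply, mul_zero, zero_mul,
    Finset.sum_const_zero, zero_add, add_zero, Complex.add_re]
  have h1 := h (fun a => v (Sum.inl a)) (fun a => w (Sum.inr a))
  have h2 := h (fun a => w (Sum.inl a)) (fun a => v (Sum.inr a))
  have h3 : (∑ a, ∑ b, conj (v (Sum.inr a)) * x.conjTranspose a b * w (Sum.inl b)).re
      = (∑ a, ∑ b, conj (w (Sum.inl a)) * x a b * v (Sum.inr b)).re := by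
    rw [← Complex.conj_re (∑ a, ∑ b, conj (v (Sum.inr a)) * x.conjTranspose a b * w (Sum.inl b))]
    congr 1
    rw [map_sum, Finset.sum_comm' (t' := Finset.univ) (s' := fun _ => Finset.univ) (by simp)]
    refine Finset.sum_congr rfl fun a _ => ?_
    rw [map_sum]
    refine Finset.sum_congr rfl fun b _ => ?_
    simp [Matrix.conjTranspose_apply]
    ring
  rw [h3]
  linarith

section
open scoped Matrix.Norms.L2Operator MatrixOrder

lemma exists_unitary_of_contr {m : Type} [Fintype m] [DecidableEq m] (x : Matrix m m ℂ)
    (hx : IsContr 1 x) (hs : IsSelfAdjoint x) :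
    ∃ u ∈ Matrix.unitaryGroup m ℂ, x = (2⁻¹ : ℂ) • (u + star u) := by
  have hn : ‖(⟨x, hs⟩ : selfAdjoint (Matrix m m ℂ))‖ ≤ 1 := by
    change ‖x‖ ≤ 1
    rw [Matrix.cstar_norm_def]
    exact (isContr_iff x 1 zero_le_one).1 hx
  refine ⟨selfAdjoint.unitarySelfAddISMul ⟨x, hs⟩ hn, (selfAdjoint.unitarySelfAddISMul ⟨x, hs⟩ hn).2, ?_⟩
  have h := congrArg Subtype.val (selfAdjoint.realPart_unitarySelfAddISMul ⟨x, hs⟩ hn)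
  rw [realPart_apply_coe] at h
  rw [show ((2⁻¹ : ℂ)) = ((2⁻¹ : ℝ) : ℂ) by simp]
  rw [Complex.coe_smul]
  exact h.symm
end

lemma mform_congr {G n m : Type} [Fintype n] [Fintype m]
    (A : G →₀ Matrix n n ℂ) (y y' : G → Matrix m m ℂ) (h : ∀ t, A t ≠ 0 → y t = y' t)
    (ξ η : n → m → ℂ) : mform A y ξ η = mform A y' ξ η := by
  unfold mform
  refine Finsupp.sum_congr fun t ht => ?_
  rw [h t (Finsupp.mem_support_iff.1 ht)]

lemma mform_add {G n m : Type} [Fintype n] [Fintype m]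
    (A : G →₀ Matrix n n ℂ) (y y' : G → Matrix m m ℂ)
    (ξ η : n → m → ℂ) : mform A (fun t => y t + y' t) ξ η = mform A y ξ η + mform A y' ξ η := by
  unfold mform Finsupp.sum
  simp only [Finset.sum_add_distrib, Matrix.add_apply, mul_add, add_mul]

lemma mform_smul {G n m : Type} [Fintype n] [Fintype m]
    (A : G →₀ Matrix n n ℂ) (y : G → Matrix m m ℂ) (c : ℂ)
    (ξ η : n → m → ℂ) : mform A (fun t => c • y t) ξ η = c * mform A y ξ η := by
  unfold mform Finsupp.sum
  simp only [Finset.mul_sum, Matrix.smul_apply, smul_eq_mul]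
  refine Finset.sum_congr rfl fun _ _ => Finset.sum_congr rfl fun _ _ =>
    Finset.sum_congr rfl fun _ _ => Finset.sum_congr rfl fun _ _ => Finset.sum_congr rfl fun _ _ => ?_
  ring

lemma contr_of_unitary {G n : Type} [Fintype n] (A : G →₀ Matrix n n ℂ) (S : ℝ)
    (h : ∀ (m : Type) [Fintype m] [DecidableEq m] (y : G → Matrix m m ℂ),
      (∀ t, y t ∈ Matrix.unitaryGroup m ℂ) → ∀ ξ η : n → m → ℂ, (mform A y ξ η).re ≤
      S * (∑ i, ∑ a, ‖ξ i a‖ ^ 2 + ∑ i, ∑ a, ‖η i a‖ ^ 2))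
    (m : Type) [Fintype m] (y : G → Matrix m m ℂ) (hy : ∀ t, A t ≠ 0 → IsContr 1 (y t))
    (ξ η : n → m → ℂ) : (mform A y ξ η).re ≤
      S * (∑ i, ∑ a, ‖ξ i a‖ ^ 2 + ∑ i, ∑ a, ‖η i a‖ ^ 2) := by
  classical
  have key : ∀ t, ∃ u ∈ Matrix.unitaryGroup (m ⊕ m) ℂ, A t ≠ 0 →
      Matrix.fromBlocks 0 (y t) (y t).conjTranspose 0 = (2⁻¹ : ℂ) • (u + star u) := by
    intro t
    by_cases ht : A t = 0
    · exact ⟨1, one_mem _, fun h => (h ht).elim⟩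
    · obtain ⟨u, hu, e⟩ := exists_unitary_of_contr _ (isContr_block _ (hy t ht)) (by
        rw [IsSelfAdjoint, Matrix.star_eq_conjTranspose, Matrix.fromBlocks_conjTranspose]; simp)
      exact ⟨u, hu, fun _ => e⟩
  choose u hu hue using key
  have e1 : mform A y ξ η = mform A (fun t => Matrix.fromBlocks 0 (y t) (y t).conjTranspose 0)
      (fun i => Sum.elim (ξ i) 0) (fun i => Sum.elim 0 (η i)) := by
    unfold mform
    refine Finsupp.sum_congr fun t _ => ?_
    simp
  rw [e1, mform_congr A _ (fun t => (2⁻¹ : ℂ) • (u t + star (u t))) hue, mform_smul, mform_add]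
  have h1 := h (m ⊕ m) u hu (fun i => Sum.elim (ξ i) 0) (fun i => Sum.elim 0 (η i))
  have h2 := h (m ⊕ m) (fun t => star (u t)) (fun t => Unitary.star_mem (hu t))
    (fun i => Sum.elim (ξ i) 0) (fun i => Sum.elim 0 (η i))
  simp only [Fintype.sum_sum_type, Sum.elim_inl, Sum.elim_inr, Pi.zero_apply, norm_zero, ne_eq,
    OfNat.ofNat_ne_zero, not_false_eq_true, zero_pow, Finset.sum_const_zero, add_zero, zero_add]
    at h1 h2
  rw [show (2⁻¹ : ℂ) = ((2⁻¹ : ℝ) : ℂ) by simp, Complex.re_ofReal_mul, Complex.add_re]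
  linarith

lemma mform_eq_opform {G n m : Type} [Fintype n] [Fintype m] [DecidableEq m]
    (A : G →₀ Matrix n n ℂ) (y : G → Matrix m m ℂ)
    (ξ η : n → m → ℂ) : mform A y ξ η = opform A (fun t => Matrix.toEuclideanCLM (𝕜 := ℂ) (y t))
      (fun i => WithLp.toLp 2 (ξ i)) (fun i => WithLp.toLp 2 (η i)) := by
  unfold mform opform
  refine Finsupp.sum_congr fun t _ => ?_
  simp only [inner_toEuclideanCLM']

lemma sum_reindex {G n H : Type} [Fintype n] [NormedAddCommGroup H] [InnerProductSpace ℂ H]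
    (Λ : Set G) (A : G →₀ Matrix n n ℂ) (hA : ∀ t, t ∉ Λ → A t = 0) {N : ℕ} (e : n ≃ Fin N)
    (v : G → H →L[ℂ] H) (ξ η : Fin N → H) :
    (((A.subtypeDomain (· ∈ Λ)).mapRange (Matrix.reindex e e) (by ext; simp) :
      ↥Λ →₀ Matrix (Fin N) (Fin N) ℂ).sum
      fun t m => ∑ i, ∑ j, m i j * ⟪ξ i, v t (η j)⟫_ℂ) = opform A v (ξ ∘ e) (η ∘ e) := by
  rw [Finsupp.sum_mapRange_index (by intro a; simp)]
  unfold opform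
  rw [← Finsupp.sum_subtypeDomain_index (p := (· ∈ Λ))]
  · refine Finsupp.sum_congr fun t _ => ?_
    rw [← e.sum_comp]
    refine Finset.sum_congr rfl fun i _ => ?_
    rw [← e.sum_comp]
    simp
  · intro t ht
    by_contra h
    exact (Finsupp.mem_support_iff.1 ht) (hA t h)

lemma CSm_of_CS {G : Type} [Group G] (Λ : Set G) (C : ℝ) (h : IsCompletelySidon Λ C) (hC : 0 ≤ C) :
    CSm Λ C := by
  classical
  intro n _ A hA D hD hR m _ y hy ξ η
  refine contr_of_unitary A (C * D / 2) ?_ m y (fun t ht => hy t (by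
    by_contra hh; exact ht (hA t hh))) ξ η
  clear hy ξ η y
  intro m _ _ y hy ξ η
  have e := Fintype.equivFin n
  have hU : ∀ t, Matrix.toEuclideanCLM (𝕜 := ℂ) (y t) ∈
      unitary (EuclideanSpace ℂ m →L[ℂ] EuclideanSpace ℂ m) := by
    intro t
    have := hy t
    rw [Unitary.mem_iff, ← map_star, ← map_mul, ← map_mul]
    rw [Matrix.mem_unitaryGroup_iff'.1 this, Matrix.mem_unitaryGroup_iff.1 this]
    simp
  have key := h _ ((A.subtypeDomain (· ∈ Λ)).mapRange (Matrix.reindex e e) (by ext; simp)) D hD ?_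
    (EuclideanSpace ℂ m) (fun t => ⟨Matrix.toEuclideanCLM (𝕜 := ℂ) (y t), hU t⟩)
  · rw [sidonOp_norm_le_iff _ _ _ (mul_nonneg hC hD)] at key
    have k2 := key (fun i => WithLp.toLp 2 (ξ (e.symm i))) (fun i => WithLp.toLp 2 (η (e.symm i)))
    have := sum_reindex Λ A hA e (fun t => Matrix.toEuclideanCLM (𝕜 := ℂ) (y t))
      (fun i => WithLp.toLp 2 (ξ (e.symm i))) (fun i => WithLp.toLp 2 (η (e.symm i)))
    rw [this] at k2
    rw [mform_eq_opform]
    rw [← e.sum_comp, ← e.sum_comp] at k2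
    simpa [Function.comp_def, EuclideanSpace.norm_sq_eq] using k2
  · intro H' _ _ _ π
    rw [sidonOp_norm_le_iff _ _ _ hD]
    intro ξ η
    have := sum_reindex Λ A hA e (fun t => (π t : H' →L[ℂ] H')) ξ η
    rw [this]
    refine (hR H' π _ _).trans (le_of_eq ?_)
    rw [← e.sum_comp, ← e.sum_comp]
    rfl

end SidonU

open scoped InnerProductSpace ComplexConjugate ComplexOrder

namespace SidonU

lemma unitary_norm_le {K : Type} [NormedAddCommGroup K] [InnerProductSpace ℂ K] [CompleteSpace K]
    {u : K →L[ℂ] K} (hu : u ∈ unitary (K →L[ℂ] K)) : ‖u‖ ≤ 1 := by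
  have h : ‖star u * u‖ = ‖u‖ * ‖u‖ := CStarRing.norm_star_mul_self
  rw [Unitary.star_mul_self_of_mem hu] at h
  have : ‖(1 : K →L[ℂ] K)‖ ≤ 1 := ContinuousLinearMap.norm_id_le
  nlinarith [norm_nonneg u]

lemma sandwich {m K : Type} [Fintype m] [NormedAddCommGroup K] [InnerProductSpace ℂ K]
    (b : m → K) (T : K →L[ℂ] K) (v w : m → ℂ) :
    ∑ a, ∑ a', conj (v a) * ⟪b a, T (b a')⟫_ℂ * w a' =
      ⟪∑ a, v a • b a, T (∑ a, w a • b a)⟫_ℂ := by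
  rw [sum_inner]
  refine Finset.sum_congr rfl fun a _ => ?_
  rw [map_sum, inner_sum]
  refine Finset.sum_congr rfl fun a' _ => ?_
  rw [map_smul, inner_smul_left, inner_smul_right]
  ring

lemma norm_sq_orthonormal {m K : Type} [Fintype m] [NormedAddCommGroup K] [InnerProductSpace ℂ K]
    (b : m → K) (hb : Orthonormal ℂ b) (v : m → ℂ) :
    ‖∑ a, v a • b a‖ ^ 2 = ∑ a, ‖v a‖ ^ 2 := by
  have h := hb.inner_sum v v Finset.univ
  rw [inner_self_eq_norm_sq_to_K] at h
  have h2 : ∀ a, conj (v a) * v a = ((‖v a‖ ^ 2 : ℝ) : ℂ) := by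
    intro a; rw [Complex.conj_mul']; norm_cast
  simp only [h2] at h
  simp only [Complex.coe_algebraMap] at h
  exact_mod_cast h

lemma exists_coords {n K : Type} [Finite n] [NormedAddCommGroup K] [InnerProductSpace ℂ K]
    (ξ η : n → K) : ∃ (d : ℕ) (b : Fin d → K), Orthonormal ℂ b ∧ ∃ c e : n → Fin d → ℂ,
      (∀ i, ξ i = ∑ a, c i a • b a) ∧ (∀ i, η i = ∑ a, e i a • b a) := by
  let V : Submodule ℂ K := Submodule.span ℂ (Set.range ξ ∪ Set.range η)
  have hfin : FiniteDimensional ℂ V :=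
    FiniteDimensional.span_of_finite ℂ ((Set.finite_range ξ).union (Set.finite_range η))
  let B := stdOrthonormalBasis ℂ V
  have hmem : ∀ x ∈ V, ∃ c : Fin (Module.finrank ℂ V) → ℂ, x = ∑ a, c a • (B a : K) := by
    intro x hx
    refine ⟨fun a => B.repr ⟨x, hx⟩ a, ?_⟩
    have := congrArg (Subtype.val) (B.sum_repr ⟨x, hx⟩)
    simpa using this.symm
  have h1 : ∀ i, ∃ c : Fin (Module.finrank ℂ V) → ℂ, ξ i = ∑ a, c a • (B a : K) := fun i =>
    hmem _ (Submodule.subset_span (Or.inl ⟨i, rfl⟩))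
  have h2 : ∀ i, ∃ c : Fin (Module.finrank ℂ V) → ℂ, η i = ∑ a, c a • (B a : K) := fun i =>
    hmem _ (Submodule.subset_span (Or.inr ⟨i, rfl⟩))
  choose c hc using h1
  choose e he using h2
  refine ⟨_, fun a => (B a : K), ?_, c, e, hc, he⟩
  exact B.orthonormal.comp_linearIsometry V.subtypeₗᵢ

lemma CS_of_CSm {G : Type} [Group G] (Λ : Set G) (C : ℝ) (h : CSm Λ C) (hC : 0 ≤ C) :
    IsCompletelySidon Λ C := by
  classical
  intro N a D hD hR K _ _ _ u
  rw [sidonOp_norm_le_iff _ _ _ (mul_nonneg hC hD)]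
  intro ξ η
  let emb : ↥Λ ↪ G := ⟨Subtype.val, Subtype.val_injective⟩
  let A : G →₀ Matrix (Fin N) (Fin N) ℂ := a.embDomain emb
  let v : G → K →L[ℂ] K := fun t => if ht : t ∈ Λ then (u ⟨t, ht⟩ : K →L[ℂ] K) else 0
  have hA : ∀ t, t ∉ Λ → A t = 0 := fun t ht =>
    Finsupp.embDomain_of_notMem_range _ _ _ (by rintro ⟨s, rfl⟩; exact ht s.2)
  have hRA : RepBd A D := by
    intro H' _ _ _ π ξ η
    have := (sidonOp_norm_le_iff _ _ _ hD).1 (hR H' π) ξ η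
    unfold opform
    rw [Finsupp.sum_embDomain]
    exact this
  obtain ⟨d, b, hb, c, e, hc, he⟩ := exists_coords ξ η
  have key := h (Fin N) A hA D hD hRA (Fin d)
    (fun t a a' => ⟪b a, v t (b a')⟫_ℂ) (by
      intro t ht x y
      rw [sandwich, ← norm_sq_orthonormal b hb, ← norm_sq_orthonormal b hb]
      refine (norm_le_iff_re _ 1 zero_le_one).1 ?_ _ _
      have : v t = (u ⟨t, ht⟩ : K →L[ℂ] K) := by simp [v, ht]
      rw [this]
      exact unitary_norm_le (u ⟨t, ht⟩).2) c e
  unfold mform at key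
  simp only [sandwich, ← norm_sq_orthonormal b hb, ← hc, ← he] at key
  rw [Finsupp.sum_embDomain] at key
  convert key using 3
  ext t m
  simp [v, emb]

lemma CS_nonneg {G : Type} [Group G] (Λ : Set G) (C : ℝ) (h : IsCompletelySidon Λ C) : 0 ≤ C := by
  have := h 0 0 1 zero_le_one (fun H' _ _ _ π => by
    rw [sidonOp_norm_le_iff _ _ _ zero_le_one]; intro ξ η; simp) ℂ (fun _ => 1)
  simpa using (norm_nonneg _).trans this

lemma CSm_one_le {G : Type} [Group G] (Λ : Set G) (C : ℝ) (h : CSm Λ C) (t : G) (ht : t ∈ Λ) :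
    1 ≤ C := by
  classical
  have := h Unit (Finsupp.single t 1) (by
    intro s hs; rw [Finsupp.single_apply, if_neg]; rintro rfl; exact hs ht) 1 zero_le_one (by
    intro H' _ _ _ π ξ η
    unfold opform
    rw [Finsupp.sum_single_index (by simp)]
    simp only [Finset.univ_unique, Finset.sum_singleton]
    have := (norm_le_iff_re (π t : H' →L[ℂ] H') 1 zero_le_one).1
      (unitary_norm_le (π t).2) (ξ default) (η default)
    simpa using this) Unit (fun _ => 1) (by
    intro t _ v w
    have := (norm_le_iff_re (ContinuousLinearMap.id ℂ ℂ) 1 zero_le_one).1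
      (ContinuousLinearMap.norm_id_le) (v default) (w default)
    simpa [mul_comm] using this) (fun _ _ => 1) (fun _ _ => 1)
  unfold mform at this
  rw [Finsupp.sum_single_index (by simp)] at this
  simp at this
  linarith

end SidonU

open scoped InnerProductSpace ComplexConjugate ComplexOrder

namespace SidonU

/-- interpolation property -/
def Interp {G : Type} [Group G] (Λ : Set G) (M ε : ℝ) : Prop :=
  ∀ (κ : Type) [Fintype κ] (x : G → Matrix κ κ ℂ), (∀ t ∈ Λ, IsContr 1 (x t)) →
    ∃ Y : G → Matrix κ κ ℂ, (∀ t ∈ Λ, Y t = x t) ∧ (∀ t, t ∉ Λ → IsContr ε (Y t)) ∧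
      ∀ (n : Type) [Fintype n] (A : G →₀ Matrix n n ℂ) (D : ℝ), 0 ≤ D → RepBd A D →
        ∀ ξ η : n → κ → ℂ, (mform A Y ξ η).re ≤
          M * D / 2 * (∑ i, ∑ a, ‖ξ i a‖ ^ 2 + ∑ i, ∑ a, ‖η i a‖ ^ 2)

lemma IsContr.neg {m : Type} [Fintype m] {c : ℝ} {x : Matrix m m ℂ} (h : IsContr c x) :
    IsContr c (-x) := by
  intro v w
  have := h (fun a => - v a) w
  simpa using this

lemma IsContr.smul {m : Type} [Fintype m] {c : ℝ} {x : Matrix m m ℂ} (h : IsContr c x)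
    (r : ℝ) (hr : 0 ≤ r) : IsContr (r * c) ((r : ℂ) • x) := by
  intro v w
  have := mul_le_mul_of_nonneg_left (h v w) hr
  have e : (∑ a, ∑ b, conj (v a) * ((r : ℂ) • x) a b * w b) =
      (r : ℂ) * (∑ a, ∑ b, conj (v a) * x a b * w b) := by
    simp only [Finset.mul_sum, Matrix.smul_apply, smul_eq_mul]
    refine Finset.sum_congr rfl fun _ _ => Finset.sum_congr rfl fun _ _ => ?_
    ring
  rw [e, Complex.re_ofReal_mul]
  linarith

lemma IsContr.norm_le {m : Type} [Fintype m] {c : ℝ} {x : Matrix m m ℂ} (h : IsContr c x)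
    (v w : m → ℂ) : ‖∑ a, ∑ b, conj (v a) * x a b * w b‖ ≤
      c / 2 * (∑ a, ‖v a‖ ^ 2 + ∑ a, ‖w a‖ ^ 2) := by
  obtain ⟨z, hz, hz2⟩ := RCLike.exists_norm_mul_eq_self (∑ a, ∑ b, conj (v a) * x a b * w b)
  obtain ⟨z, hz, hz2⟩ : ∃ z : ℂ, ‖z‖ = 1 ∧ z * (∑ a, ∑ b, conj (v a) * x a b * w b) =
      (‖∑ a, ∑ b, conj (v a) * x a b * w b‖ : ℂ) := by
    obtain ⟨z, hz, hz2⟩ := RCLike.exists_norm_eq_mul_self (∑ a, ∑ b, conj (v a) * x a b * w b)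
    exact ⟨z, hz, hz2.symm⟩
  have := h v (fun b => z * w b)
  have e : (∑ a, ∑ b, conj (v a) * x a b * (z * w b)) =
      z * (∑ a, ∑ b, conj (v a) * x a b * w b) := by
    simp only [Finset.mul_sum]
    refine Finset.sum_congr rfl fun _ _ => Finset.sum_congr rfl fun _ _ => ?_
    ring
  rw [e, hz2, Complex.ofReal_re] at this
  simpa [hz] using this

lemma crude {G n : Type} [Fintype n] (A : G →₀ Matrix n n ℂ) :
    ∃ S : ℝ, ∀ (m : Type) [Fintype m] (y : G → Matrix m m ℂ), (∀ t, A t ≠ 0 → IsContr 1 (y t)) →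
    ∀ ξ η : n → m → ℂ, (mform A y ξ η).re ≤
      S * (∑ i, ∑ a, ‖ξ i a‖ ^ 2 + ∑ i, ∑ a, ‖η i a‖ ^ 2) := by
  refine ⟨∑ t ∈ A.support, ∑ i, ∑ j, ‖A t i j‖ * (1 / 2), ?_⟩
  intro m _ y hy ξ η
  refine (Complex.re_le_norm _).trans ?_
  unfold mform Finsupp.sum
  simp only [Finset.sum_mul]
  refine (norm_sum_le _ _).trans (Finset.sum_le_sum fun t ht => ?_)
  refine (norm_sum_le _ _).trans (Finset.sum_le_sum fun i _ => ?_)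
  refine (norm_sum_le _ _).trans (Finset.sum_le_sum fun j _ => ?_)
  rw [norm_mul, mul_assoc]
  refine mul_le_mul_of_nonneg_left ?_ (norm_nonneg _)
  refine ((hy t (Finsupp.mem_support_iff.1 ht)).norm_le (ξ i) (η j)).trans ?_
  refine mul_le_mul_of_nonneg_left ?_ (by norm_num)
  have h1 := Finset.single_le_sum (f := fun i => ∑ a, ‖ξ i a‖ ^ 2)
    (fun i _ => Finset.sum_nonneg fun a _ => by positivity) (Finset.mem_univ i)
  have h2 := Finset.single_le_sum (f := fun i => ∑ a, ‖η i a‖ ^ 2)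
    (fun i _ => Finset.sum_nonneg fun a _ => by positivity) (Finset.mem_univ j)
  exact add_le_add h1 h2

theorem CSm_of_Interp {G : Type} [Group G] (Λ₁ Λ₂ : Set G) (M₁ M₂ ε : ℝ) (hε₀ : 0 < ε)
    (hε₁ : ε < 1) (h₁ : Interp Λ₁ M₁ ε) (h₂ : Interp (Λ₂ \ Λ₁) M₂ ε) :
    CSm (Λ₁ ∪ Λ₂) ((M₁ + M₂) / (1 - ε)) := by
  intro n _ A hA D hD hR
  obtain ⟨S0, hS0⟩ := crude A
  set K := (M₁ + M₂) * D / 2 with hK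
  have step : ∀ S : ℝ, (∀ (m : Type) [Fintype m] (y : G → Matrix m m ℂ),
      (∀ t ∈ Λ₁ ∪ Λ₂, IsContr 1 (y t)) → ∀ ξ η : n → m → ℂ, (mform A y ξ η).re ≤
      S * (∑ i, ∑ a, ‖ξ i a‖ ^ 2 + ∑ i, ∑ a, ‖η i a‖ ^ 2)) →
      (∀ (m : Type) [Fintype m] (y : G → Matrix m m ℂ),
      (∀ t ∈ Λ₁ ∪ Λ₂, IsContr 1 (y t)) → ∀ ξ η : n → m → ℂ, (mform A y ξ η).re ≤
      (K + ε * S) * (∑ i, ∑ a, ‖ξ i a‖ ^ 2 + ∑ i, ∑ a, ‖η i a‖ ^ 2)) := by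
    intro S hS m _ y hy ξ η
    obtain ⟨Y1, hY1, hY1', hb1⟩ := h₁ m y (fun t ht => hy t (Or.inl ht))
    obtain ⟨Y2, hY2, hY2', hb2⟩ := h₂ m y (fun t ht => hy t (Or.inr ht.1))
    have e : y = fun t => (Y1 t + Y2 t) + (ε : ℂ) • (((ε⁻¹ : ℝ) : ℂ) • (y t - Y1 t - Y2 t)) := by
      funext t
      rw [smul_smul, Complex.ofReal_inv, mul_inv_cancel₀ (by exact_mod_cast hε₀.ne'), one_smul]
      abel
    have hz : ∀ t ∈ Λ₁ ∪ Λ₂, IsContr 1 (((ε⁻¹ : ℝ) : ℂ) • (y t - Y1 t - Y2 t)) := by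
      intro t ht
      rw [← inv_mul_cancel₀ hε₀.ne']
      refine IsContr.smul ?_ _ (by positivity)
      by_cases h : t ∈ Λ₁
      · rw [hY1 t h, sub_self, zero_sub]
        exact (hY2' t (fun hh => hh.2 h)).neg
      · have h2 : t ∈ Λ₂ \ Λ₁ := ⟨ht.resolve_left h, h⟩
        rw [hY2 t h2, sub_right_comm, sub_self, zero_sub]
        exact (hY1' t h).neg
    have b1 := hb1 n A D hD hR ξ η
    have b2 := hb2 n A D hD hR ξ η
    have b3 := mul_le_mul_of_nonneg_left (hS m _ hz ξ η) hε₀.le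
    rw [e, mform_add, mform_add, mform_smul, Complex.add_re, Complex.add_re,
      Complex.re_ofReal_mul]
    refine (add_le_add (add_le_add b1 b2) b3).trans (le_of_eq ?_)
    rw [hK]; ring
  have it : ∀ k : ℕ, ∀ (m : Type) [Fintype m] (y : G → Matrix m m ℂ),
      (∀ t ∈ Λ₁ ∪ Λ₂, IsContr 1 (y t)) → ∀ ξ η : n → m → ℂ, (mform A y ξ η).re ≤
      (K / (1 - ε) + ε ^ k * (S0 - K / (1 - ε))) *
        (∑ i, ∑ a, ‖ξ i a‖ ^ 2 + ∑ i, ∑ a, ‖η i a‖ ^ 2) := by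
    intro k
    induction k with
    | zero =>
      intro m _ y hy ξ η
      refine (hS0 m y (fun t ht => hy t (by by_contra hh; exact ht (hA t hh))) ξ η).trans
        (le_of_eq ?_)
      ring
    | succ k ih =>
      have := step _ ih
      have h1 : 1 - ε ≠ 0 := by linarith
      have e : K / (1 - ε) + ε ^ (k + 1) * (S0 - K / (1 - ε)) =
          K + ε * (K / (1 - ε) + ε ^ k * (S0 - K / (1 - ε))) := by
        have h2 : K / (1 - ε) * (1 - ε) = K := div_mul_cancel₀ _ h1
        rw [pow_succ]
        linear_combination h2
      rw [e]
      exact this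
  intro m _ y hy ξ η
  have lim : Filter.Tendsto (fun k : ℕ => (K / (1 - ε) + ε ^ k * (S0 - K / (1 - ε))) *
        (∑ i, ∑ a, ‖ξ i a‖ ^ 2 + ∑ i, ∑ a, ‖η i a‖ ^ 2)) Filter.atTop
      (nhds ((K / (1 - ε) + 0 * (S0 - K / (1 - ε))) *
        (∑ i, ∑ a, ‖ξ i a‖ ^ 2 + ∑ i, ∑ a, ‖η i a‖ ^ 2))) := by
    refine Filter.Tendsto.mul_const _ (Filter.Tendsto.const_add _ (Filter.Tendsto.mul_const _ ?_))
    exact tendsto_pow_atTop_nhds_zero_of_lt_one hε₀.le hε₁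
  refine (ge_of_tendsto' lim (fun k => it k m y hy ξ η)).trans (le_of_eq ?_)
  rw [hK]; ring

end SidonU

open scoped InnerProductSpace ComplexConjugate ComplexOrder

namespace SidonU

lemma herm_of_form {X : Type} (K : Matrix X X ℂ)
    (h : ∀ c : X →₀ ℂ, 0 ≤ c.sum fun i xi ↦ c.sum fun j xj ↦ star xi * K i j * xj) :
    K.PosSemidef := by
  classical
  refine ⟨?_, h⟩
  have im : ∀ c : X →₀ ℂ, (c.sum fun i xi ↦ c.sum fun j xj ↦ star xi * K i j * xj).im = 0 :=
    fun c => (Complex.nonneg_iff.1 (h c)).2.symm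
  have ex : ∀ (x y : X) (a b : ℂ), ((Finsupp.single x a + Finsupp.single y b).sum fun i xi ↦
      (Finsupp.single x a + Finsupp.single y b).sum fun j xj ↦ star xi * K i j * xj) =
      star a * K x x * a + star a * K x y * b + star b * K y x * a + star b * K y y * b := by
    intro x y a b
    have inner : ∀ (i : X) (xi : ℂ), ((Finsupp.single x a + Finsupp.single y b).sum fun j xj ↦
        star xi * K i j * xj) = star xi * K i x * a + star xi * K i y * b := by
      intro i xi
      rw [Finsupp.sum_add_index' (by simp) (by intros; ring), Finsupp.sum_single_index (by simp),
        Finsupp.sum_single_index (by simp)]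
    simp only [inner]
    rw [Finsupp.sum_add_index' (by simp) (by intros; simp only [star_add]; ring),
      Finsupp.sum_single_index (by simp), Finsupp.sum_single_index (by simp)]
    ring
  have dg : ∀ x, (K x x).im = 0 := by
    intro x
    have := im (Finsupp.single x 1)
    rw [Finsupp.sum_single_index (by simp), Finsupp.sum_single_index (by simp)] at this
    simpa using this
  ext x y
  rw [Matrix.conjTranspose_apply]
  have h1 := im (Finsupp.single x 1 + Finsupp.single y 1)
  have h2 := im (Finsupp.single x 1 + Finsupp.single y Complex.I)
  rw [ex] at h1 h2
  have d1 := dg x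
  have d2 := dg y
  simp at h1 h2
  apply Complex.ext
  · simp; linarith
  · simp; linarith

lemma psd_gram {X E : Type} [NormedAddCommGroup E] [InnerProductSpace ℂ E] (v : X → E) :
    (Matrix.of fun x y => ⟪v x, v y⟫_ℂ).PosSemidef := by
  refine herm_of_form _ fun c => ?_
  have : (c.sum fun i xi ↦ c.sum fun j xj ↦ star xi * (Matrix.of fun x y => ⟪v x, v y⟫_ℂ) i j * xj)
      = ⟪c.sum fun i xi => xi • v i, c.sum fun i xi => xi • v i⟫_ℂ := by
    unfold Finsupp.sum
    rw [sum_inner]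
    refine Finset.sum_congr rfl fun i _ => ?_
    rw [inner_sum]
    refine Finset.sum_congr rfl fun j _ => ?_
    rw [inner_smul_left, inner_smul_right]
    simp; ring
  rw [this]
  rw [inner_self_eq_norm_sq_to_K]
  simp only [Complex.coe_algebraMap]
  exact_mod_cast (sq_nonneg ‖c.sum fun i xi => xi • v i‖)

lemma psd_eq {X Y : Type} [DecidableEq Y] (f : X → Y) :
    (Matrix.of fun x y => if f x = f y then (1 : ℂ) else 0).PosSemidef := by
  have := (Matrix.PosSemidef.one (n := Y) (R := ℂ)).submatrix f
  convert this using 1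
  ext x y
  simp [Matrix.one_apply]

lemma psd_mul {X : Type} {K L : X → X → ℂ} (hK : (Matrix.of K).PosSemidef)
    (hL : (Matrix.of L).PosSemidef) : (Matrix.of fun x y => K x y * L x y).PosSemidef :=
  hK.hadamard hL

lemma psd_gns {X : Type} (K : X → X → ℂ) (hK : (Matrix.of K).PosSemidef) :
    ∃ (H : Type) (_ : NormedAddCommGroup H) (_ : InnerProductSpace ℂ H) (_ : CompleteSpace H)
      (v : X → H), (∀ x y, ⟪v x, v y⟫_ℂ = K x y) ∧
        DenseRange (Finsupp.linearCombination ℂ v) := by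
  let K' : Matrix X X (ℂ →L[ℂ] ℂ) := Matrix.of fun x y => K x y • ContinuousLinearMap.id ℂ ℂ
  have hK' : K'.PosSemidef := by
    have tf := RKHS.posSemidef_tfae (K := K')
    refine (tf.out 0 2 rfl rfl).2 ⟨?_, ?_⟩
    · ext x y
      have := congrFun (congrFun hK.1 x) y
      simp only [Matrix.conjTranspose_apply, Matrix.of_apply] at this
      have hid : star (ContinuousLinearMap.id ℂ ℂ) = ContinuousLinearMap.id ℂ ℂ :=
        star_one (ℂ →L[ℂ] ℂ)
      simp [K', Matrix.conjTranspose_apply, ← this, hid]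
    · intro c
      have := (Complex.nonneg_iff.1 (hK.2 c)).1
      convert this using 1
      refine congrArg Complex.re ?_
      unfold Finsupp.sum
      refine Finset.sum_congr rfl fun i _ => Finset.sum_congr rfl fun j _ => ?_
      have := congrFun (congrFun hK.1 i) j
      simp only [Matrix.conjTranspose_apply, Matrix.of_apply] at this
      simp only [K', Matrix.of_apply]
      simp [← this]
      ring
  have : Fact K'.PosSemidef := ⟨hK'⟩
  let H := RKHS.OfKernel K'
  refine ⟨H, inferInstance, inferInstance, inferInstance, fun x => RKHS.kerFun H x 1, ?_, ?_⟩
  · intro x y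
    rw [← RKHS.kernel_inner, RKHS.OfKernel.kernel_ofKernel]
    have := congrFun (congrFun hK.1 x) y
    simp only [Matrix.conjTranspose_apply, Matrix.of_apply] at this
    simp [K', ← this]
  · have := RKHS.kerFun_dense H
    rw [← Submodule.dense_iff_topologicalClosure_eq_top] at this
    refine this.mono ?_
    intro z hz
    refine Submodule.span_le (p := LinearMap.range (Finsupp.linearCombination ℂ
      (fun x => RKHS.kerFun H x 1))) |>.2 ?_ hz
    rintro _ ⟨x, c, rfl⟩
    refine ⟨Finsupp.single x c, ?_⟩
    rw [Finsupp.linearCombination_single, ← map_smul]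
    simp

end SidonU

open scoped InnerProductSpace ComplexConjugate ComplexOrder

namespace SidonU

lemma ext_dense {X H F : Type} [NormedAddCommGroup H] [InnerProductSpace ℂ H]
    [NormedAddCommGroup F] [NormedSpace ℂ F] {v : X → H}
    (hd : DenseRange (Finsupp.linearCombination ℂ v)) {S T : H →L[ℂ] F}
    (h : ∀ x, S (v x) = T (v x)) : S = T := by
  have : (S : H → F) = T := by
    refine hd.equalizer S.continuous T.continuous ?_
    funext c
    simp [Finsupp.linearCombination_apply, Finsupp.sum, map_sum, h]
  exact DFunLike.coe_injective this

lemma inner_lc {X H : Type} [NormedAddCommGroup H] [InnerProductSpace ℂ H] (v : X → H)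
    (c d : X →₀ ℂ) : ⟪Finsupp.linearCombination ℂ v c, Finsupp.linearCombination ℂ v d⟫_ℂ =
      c.sum fun x z => d.sum fun y w => conj z * w * ⟪v x, v y⟫_ℂ := by
  simp only [Finsupp.linearCombination_apply, Finsupp.sum]
  rw [sum_inner]
  refine Finset.sum_congr rfl fun i _ => ?_
  rw [inner_sum]
  refine Finset.sum_congr rfl fun j _ => ?_
  rw [inner_smul_left, inner_smul_right]
  ring

lemma norm_lc_eq {X H H' : Type} [NormedAddCommGroup H] [InnerProductSpace ℂ H]
    [NormedAddCommGroup H'] [InnerProductSpace ℂ H'] (v : X → H) (w : X → H')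
    (h : ∀ x y, ⟪v x, v y⟫_ℂ = ⟪w x, w y⟫_ℂ) (c : X →₀ ℂ) :
    ‖Finsupp.linearCombination ℂ v c‖ = ‖Finsupp.linearCombination ℂ w c‖ := by
  have e : ⟪Finsupp.linearCombination ℂ v c, Finsupp.linearCombination ℂ v c⟫_ℂ =
      ⟪Finsupp.linearCombination ℂ w c, Finsupp.linearCombination ℂ w c⟫_ℂ := by
    rw [inner_lc, inner_lc]; simp only [h]
  rw [@norm_eq_sqrt_re_inner ℂ, @norm_eq_sqrt_re_inner ℂ, e]

lemma gns_rep {Γ X : Type} [Group Γ] (act : Γ → X → X) (h1 : ∀ x, act 1 x = x)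
    (hm : ∀ g h x, act (g * h) x = act g (act h x)) (K : X → X → ℂ)
    (hK : (Matrix.of K).PosSemidef) (hinv : ∀ g x y, K (act g x) (act g y) = K x y) :
    ∃ (H : Type) (_ : NormedAddCommGroup H) (_ : InnerProductSpace ℂ H) (_ : CompleteSpace H)
      (v : X → H) (π : Γ →* unitary (H →L[ℂ] H)), (∀ x y, ⟪v x, v y⟫_ℂ = K x y) ∧
        ∀ g x, (π g : H →L[ℂ] H) (v x) = v (act g x) := by
  obtain ⟨H, _, _, _, v, hv, hd⟩ := psd_gns K hK
  let T : Γ → H →L[ℂ] H := fun g =>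
    (Finsupp.linearCombination ℂ (fun x => v (act g x))).extendOfNorm (Finsupp.linearCombination ℂ v)
  have hT : ∀ g x, T g (v x) = v (act g x) := by
    intro g x
    have := LinearMap.extendOfNorm_eq (f := Finsupp.linearCombination ℂ (fun x => v (act g x)))
      (e := Finsupp.linearCombination ℂ v) hd ⟨1, fun c => by
        rw [one_mul]
        exact (norm_lc_eq _ _ (fun x y => by rw [hv, hv, hinv]) c).le⟩ (Finsupp.single x 1)
    simpa using this
  have hmul : ∀ g h, T (g * h) = T g * T h := fun g h => ext_dense hd fun x => by
    rw [ContinuousLinearMap.mul_apply, hT, hT, hT, hm]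
  have hone : T 1 = 1 := ext_dense hd fun x => by
    rw [hT, h1]; rfl
  have hadj : ∀ g, star (T g) = T g⁻¹ := by
    intro g
    refine ext_dense hd fun x => ?_
    refine ext_inner_right ℂ fun b => ?_
    rw [ContinuousLinearMap.star_eq_adjoint, ContinuousLinearMap.adjoint_inner_left]
    have : (innerSL ℂ (v x)).comp (T g) = innerSL ℂ (T g⁻¹ (v x)) := ext_dense hd fun y => by
      rw [ContinuousLinearMap.comp_apply, innerSL_apply_apply, innerSL_apply_apply, hT, hT, hv, hv]
      rw [← hinv g (act g⁻¹ x) y, ← hm, mul_inv_cancel, h1]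
    simpa using DFunLike.congr_fun this b
  refine ⟨H, inferInstance, inferInstance, inferInstance, v,
    { toFun := fun g => ⟨T g, by
        rw [Unitary.mem_iff, hadj, ← hmul, ← hmul]; simp [hone]⟩
      map_one' := Subtype.ext hone
      map_mul' := fun g h => Subtype.ext (hmul g h) }, hv, hT⟩

end SidonU

open scoped InnerProductSpace ComplexConjugate ComplexOrder

namespace SidonU

/-- square-summable functions -/
noncomputable abbrev L2 (F : Type) := lp (fun _ : F => ℂ) 2

open Classical in
/-- basis vector -/
noncomputable abbrev dl {F : Type} (s : F) : L2 F := lp.single 2 s (1 : ℂ)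

lemma inner_dl {F : Type} (s : F) (x : L2 F) : ⟪dl s, x⟫_ℂ = x s := by
  classical
  rw [dl, lp.inner_single_left]; simp

lemma ext_dl {F H : Type} [NormedAddCommGroup H] [InnerProductSpace ℂ H]
    {S T : L2 F →L[ℂ] H} (h : ∀ s, S (dl s) = T (dl s)) : S = T := by
  classical
  refine lp.ext_continuousLinearMap (ENNReal.ofNat_ne_top (n := nat_lit 2)) fun i => ?_
  ext
  exact h i

lemma exists_T {F H : Type} [NormedAddCommGroup H] [InnerProductSpace ℂ H] [CompleteSpace H]
    (v : F → H) (c : ℝ) (h0 : ∀ s t, s ≠ t → ⟪v s, v t⟫_ℂ = 0) (hc : ∀ s, ‖v s‖ = c) :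
    ∃ T : L2 F →L[ℂ] H, ∀ s, T (dl s) = v s := by
  classical
  by_cases hc0 : c = 0
  · refine ⟨0, fun s => ?_⟩
    have : v s = 0 := by rw [← norm_eq_zero, hc, hc0]
    simp [this]
  · have ho : Orthonormal ℂ (fun s => ((c : ℂ)⁻¹) • v s) := by
      constructor
      · intro s
        rw [norm_smul, hc, norm_inv, Complex.norm_real, ← hc s, norm_norm, hc]
        exact inv_mul_cancel₀ hc0
      · intro s t hst
        simp only [inner_smul_left, inner_smul_right]
        rw [h0 s t hst]; simp
    refine ⟨(c : ℂ) • ho.orthogonalFamily.linearIsometry.toContinuousLinearMap, fun s => ?_⟩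
    have := ho.orthogonalFamily.linearIsometry_apply_single (i := s) (1 : ℂ)
    have hc' : (c : ℂ) ≠ 0 := by exact_mod_cast hc0
    simp only [smul_apply, LinearIsometry.coe_toContinuousLinearMap]
    rw [dl, this]
    simp [smul_smul, hc']

lemma conv_prod {F : Type} (A B : L2 F →L[ℂ] L2 F) (s t : F) :
    ⟪dl s, A (B (dl t))⟫_ℂ = ∑' r, ⟪dl s, A (dl r)⟫_ℂ * ⟪dl r, B (dl t)⟫_ℂ := by
  rw [← ContinuousLinearMap.adjoint_inner_left, lp.inner_eq_tsum]
  refine tsum_congr fun r => ?_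
  rw [← inner_dl r (B (dl t)), ← inner_dl r ((ContinuousLinearMap.adjoint A) (dl s)),
    ContinuousLinearMap.adjoint_inner_right, RCLike.inner_apply, inner_conj_symm, mul_comm]

lemma conv_comm {F : Type} [Group F] (A B : L2 F →L[ℂ] L2 F) (a b : F → ℂ)
    (hA : ∀ s t, ⟪dl s, A (dl t)⟫_ℂ = a (s * t⁻¹)) (hB : ∀ s t, ⟪dl s, B (dl t)⟫_ℂ = b (s⁻¹ * t)) :
    A.comp B = B.comp A := by
  refine ext_dl fun t => ?_
  refine lp.ext (funext fun s => ?_)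
  rw [← inner_dl, ← inner_dl]
  simp only [ContinuousLinearMap.comp_apply]
  rw [conv_prod, conv_prod]
  simp only [hA, hB]
  rw [← ((Equiv.inv F).trans ((Equiv.mulLeft s).trans (Equiv.mulRight t))).tsum_eq
    (fun r => b (s⁻¹ * r) * a (r * t⁻¹))]
  refine tsum_congr fun r => ?_
  simp [mul_assoc, mul_comm]

lemma exists_sqrt {H : Type} [NormedAddCommGroup H] [InnerProductSpace ℂ H] [CompleteSpace H]
    (b : H →L[ℂ] H) (hb : b.IsPositive) : ∃ R : H →L[ℂ] H, (∀ x, R (R x) = b x) ∧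
      (∀ x y, ⟪x, R y⟫_ℂ = ⟪R x, y⟫_ℂ) ∧ ∀ A : H →L[ℂ] H, (∀ y, b (A y) = A (b y)) →
        ∀ y, R (A y) = A (R y) := by
  have hbpos : 0 ≤ b := (ContinuousLinearMap.nonneg_iff_isPositive _).2 hb
  refine ⟨CFC.sqrt b, ?_, ?_, ?_⟩
  · intro x
    exact congrArg (fun f : H →L[ℂ] H => f x) (CFC.sqrt_mul_sqrt_self b hbpos)
  · have h1 : IsSelfAdjoint (CFC.sqrt b) := (CFC.sqrt_nonneg b).isSelfAdjoint
    intro x y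
    rw [← ContinuousLinearMap.adjoint_inner_left, ← ContinuousLinearMap.star_eq_adjoint, h1.star_eq]
  · intro A hA y
    have hc : Commute b A := ContinuousLinearMap.ext hA
    have h := hc.cfcₙ_nnreal NNReal.sqrt
    exact congrArg (fun f : H →L[ℂ] H => f y) h.eq

lemma schur_sum {F J : Type} [Group F] [Fintype J] (a b : J → J → F → ℂ)
    (ha : (Matrix.of fun x y : F × J => a x.2 y.2 (x.1⁻¹ * y.1)).PosSemidef)
    (hb : (Matrix.of fun x y : F × J => b x.2 y.2 (x.1⁻¹ * y.1)).PosSemidef)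
    (ha0 : ∀ j u, u ≠ 1 → a j j u = 0) (hb0 : ∀ j u, u ≠ 1 → b j j u = 0) (c : J → ℂ) :
    0 ≤ ∑ i, ∑ j, conj (c i) * (∑' u, a i j u * b i j u) * c j := by
  classical
  have key : ∀ a : J → J → F → ℂ, 
      (Matrix.of fun x y : F × J => a x.2 y.2 (x.1⁻¹ * y.1)).PosSemidef →
      (∀ j u, u ≠ 1 → a j j u = 0) → ∃ (H : Type) (_ : NormedAddCommGroup H)
      (_ : InnerProductSpace ℂ H) (_ : CompleteSpace H) (S T : J → L2 F →L[ℂ] H),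
      (∀ i j s t, ⟪S i (dl s), S j (dl t)⟫_ℂ = a i j (s⁻¹ * t)) ∧
      (∀ i j s t, ⟪T i (dl s), T j (dl t)⟫_ℂ = a i j (s * t⁻¹)) := by
    intro a ha ha0
    obtain ⟨H, _, _, _, v, hv, -⟩ := psd_gns (fun x y : F × J => a x.2 y.2 (x.1⁻¹ * y.1)) ha
    have hn : ∀ j s, ‖v (s, j)‖ = Real.sqrt (a j j 1).re := by
      intro j s
      rw [@norm_eq_sqrt_re_inner ℂ, hv]; simp
    have h0 : ∀ j s t, s ≠ t → ⟪v (s, j), v (t, j)⟫_ℂ = 0 := by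
      intro j s t hst
      rw [hv]
      exact ha0 _ _ (by simpa [inv_mul_eq_one] using hst)
    have h1 := fun j => exists_T (fun s => v (s, j)) _ (h0 j) (hn j)
    have h2 := fun j => exists_T (fun s => v (s⁻¹, j)) _ (fun s t hst => h0 j _ _ (by simpa using hst))
      (fun s => hn j _)
    choose S hS using h1
    choose T hT using h2
    refine ⟨H, _, _, inferInstance, S, T, ?_, ?_⟩
    · intro i j s t; rw [hS, hS, hv]
    · intro i j s t; rw [hT, hT, hv]; simp
  obtain ⟨H₁, _, _, _, -, T, -, hT⟩ := key a ha ha0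
  obtain ⟨H₂, _, _, _, S, -, hS, -⟩ := key b hb hb0
  clear key
  let A : J → J → L2 F →L[ℂ] L2 F := fun i j => (ContinuousLinearMap.adjoint (T i)).comp (T j)
  let B : J → J → L2 F →L[ℂ] L2 F := fun i j => (ContinuousLinearMap.adjoint (S i)).comp (S j)
  have hA : ∀ i j s t, ⟪dl s, A i j (dl t)⟫_ℂ = a i j (s * t⁻¹) := fun i j s t => by
    simp only [A, ContinuousLinearMap.comp_apply, ContinuousLinearMap.adjoint_inner_right, hT]
  have hB : ∀ i j s t, ⟪dl s, B i j (dl t)⟫_ℂ = b i j (s⁻¹ * t) := fun i j s t => by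
    simp only [B, ContinuousLinearMap.comp_apply, ContinuousLinearMap.adjoint_inner_right, hS]
  have hcomm : ∀ i j k l x, A i j (B k l x) = B k l (A i j x) := fun i j k l x => by
    have := conv_comm (A i j) (B k l) _ _ (hA i j) (hB k l)
    exact congrArg (fun f => f x) this
  have hval : ∀ i j, (∑' u, a i j u * b i j u) = ⟪dl (1 : F), A i j (B i j (dl 1))⟫_ℂ := by
    intro i j
    rw [conv_prod]
    simp only [hA, hB]
    rw [← (Equiv.inv F).tsum_eq]
    simp
  let P := PiLp 2 (fun _ : J => L2 F)
  let pr : J → P →L[ℂ] L2 F := fun j => PiLp.proj 2 (fun _ : J => L2 F) j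
  let X : P →L[ℂ] H₂ := ∑ j, (S j).comp (pr j)
  let At : J → J → P →L[ℂ] P := fun i j =>
    ((PiLp.continuousLinearEquiv 2 ℂ (fun _ : J => L2 F)).symm : _ →L[ℂ] P).comp
      (ContinuousLinearMap.pi fun k => (A i j).comp (pr k))
  have hAt : ∀ i j y k, (At i j y) k = A i j (y k) := fun i j y k => rfl
  have hX : ∀ y, X y = ∑ j, S j (y j) := fun y => by
    simp only [X, sum_apply, ContinuousLinearMap.comp_apply]; rfl
  have hAadj : ∀ i j (x y : L2 F), ⟪x, A i j y⟫_ℂ = ⟪A j i x, y⟫_ℂ := fun i j x y => by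
    simp only [A, ContinuousLinearMap.comp_apply, ContinuousLinearMap.adjoint_inner_right,
      ContinuousLinearMap.adjoint_inner_left]
  have hAtadj : ∀ i j (x y : P), ⟪x, At i j y⟫_ℂ = ⟪At j i x, y⟫_ℂ := fun i j x y => by
    rw [PiLp.inner_apply, PiLp.inner_apply]
    refine Finset.sum_congr rfl fun k _ => ?_
    rw [hAt, hAt, hAadj]
  let bO : P →L[ℂ] P := X.adjoint.comp X
  have hbO : ∀ x y : P, ⟪x, bO y⟫_ℂ = ∑ k, ∑ l, ⟪x k, B k l (y l)⟫_ℂ := fun x y => by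
    simp only [bO, ContinuousLinearMap.comp_apply, ContinuousLinearMap.adjoint_inner_right, hX]
    rw [sum_inner]
    refine Finset.sum_congr rfl fun k _ => ?_
    rw [inner_sum]
    refine Finset.sum_congr rfl fun l _ => ?_
    simp only [B, ContinuousLinearMap.comp_apply, ContinuousLinearMap.adjoint_inner_right]
  have hc1 : ∀ i j y, bO (At i j y) = At i j (bO y) := by
    intro i j y
    refine ext_inner_left ℂ fun x => ?_
    rw [hbO, hAtadj, hbO]
    refine Finset.sum_congr rfl fun k _ => Finset.sum_congr rfl fun l _ => ?_
    rw [hAt, hAt, ← hAadj, hcomm]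
  obtain ⟨R, hR, hRs, hc⟩ := exists_sqrt bO (ContinuousLinearMap.isPositive_adjoint_comp_self X)
  have hc2 : ∀ i j y, R (At i j y) = At i j (R y) := fun i j => hc _ (hc1 i j)
  let e : J → P := fun j => WithLp.toLp 2 (Pi.single j (dl 1))
  have hval2 : ∀ i j, (∑' u, a i j u * b i j u) =
      ∑ k, ⟪T i ((R (e i)) k), T j ((R (e j)) k)⟫_ℂ := by
    intro i j
    have h1 : ⟪e i, At i j (bO (e j))⟫_ℂ = ⟪dl (1 : F), A i j (B i j (dl 1))⟫_ℂ := by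
      rw [hAtadj, hbO, Finset.sum_eq_single i, Finset.sum_eq_single j, hAt, ← hAadj]
      · simp [e]
      · intro l _ hl
        simp [e, hl]
      · simp
      · intro l _ hl
        simp [e, hl, hAt]
      · simp
    rw [hval, ← h1, ← hR, ← hc2, hRs, PiLp.inner_apply]
    refine Finset.sum_congr rfl fun k _ => ?_
    rw [hAt]
    simp only [A, ContinuousLinearMap.comp_apply, ContinuousLinearMap.adjoint_inner_right]
  have : ∑ i, ∑ j, conj (c i) * (∑' u, a i j u * b i j u) * c j =
      ∑ k, ⟪∑ i, c i • T i ((R (e i)) k), ∑ j, c j • T j ((R (e j)) k)⟫_ℂ := by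
    have h3 : ∀ k, ⟪∑ i, c i • T i ((R (e i)) k), ∑ j, c j • T j ((R (e j)) k)⟫_ℂ =
        ∑ i, ∑ j, conj (c i) * ⟪T i ((R (e i)) k), T j ((R (e j)) k)⟫_ℂ * c j := fun k => by
      rw [sum_inner]
      refine Finset.sum_congr rfl fun i _ => ?_
      rw [inner_sum]
      refine Finset.sum_congr rfl fun j _ => ?_
      rw [inner_smul_left, inner_smul_right]; ring
    simp only [h3]
    symm
    rw [Finset.sum_comm]
    refine Finset.sum_congr rfl fun i _ => ?_
    rw [Finset.sum_comm]
    refine Finset.sum_congr rfl fun j _ => ?_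
    rw [hval2, Finset.mul_sum, Finset.sum_mul]
  rw [this]
  refine Finset.sum_nonneg fun k _ => ?_
  rw [inner_self_eq_norm_sq_to_K]
  positivity

end SidonU

open scoped InnerProductSpace ComplexConjugate ComplexOrder

namespace SidonU

lemma resfin {α : Type} (W : Finset (FreeGroup α)) :
    ∃ (Q : Type) (_ : Group Q) (_ : Fintype Q) (q : FreeGroup α →* Q), Set.InjOn q W := by
  classical
  let S : Finset (FreeGroup α) := insert 1
    (W.biUnion fun w => (w.toWord.tails.map FreeGroup.mk).toFinset)
  have h1 : (1 : FreeGroup α) ∈ S := Finset.mem_insert_self _ _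
  have hσ : ∀ t : α, ∃ σ : Equiv.Perm S, ∀ s (h : s ∈ S) (h' : FreeGroup.of t * s ∈ S),
      σ ⟨s, h⟩ = ⟨FreeGroup.of t * s, h'⟩ := by
    intro t
    obtain ⟨σ, hσ⟩ := Equiv.Perm.exists_extending_pair
      (α := {s : S // FreeGroup.of t * s.1 ∈ S}) (β := S) (fun s => s.1)
      (fun s => ⟨FreeGroup.of t * s.1.1, s.2⟩) (fun a b h => Subtype.ext h)
      (fun a b h => by
        have := congrArg Subtype.val h
        simp only [mul_right_inj] at this
        exact Subtype.ext (Subtype.ext this))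
    refine ⟨σ, fun s h h' => ?_⟩
    exact hσ ⟨⟨s, h⟩, h'⟩
  choose σ hσ using hσ
  refine ⟨Equiv.Perm S, inferInstance, inferInstance, FreeGroup.lift σ, ?_⟩
  have key : ∀ L : List (α × Bool), (∀ L', L' <:+ L → FreeGroup.mk L' ∈ S) →
      ((FreeGroup.lift σ (FreeGroup.mk L)) ⟨1, h1⟩ : FreeGroup α) = FreeGroup.mk L := by
    intro L
    induction L with
    | nil => intro _; rfl
    | cons x L ih =>
      intro h
      have ih' := ih fun L' hL' => h L' (hL'.trans (List.suffix_cons _ _))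
      have hL : FreeGroup.mk L ∈ S := h L (List.suffix_cons _ _)
      have hx : FreeGroup.mk (x :: L) ∈ S := h _ List.suffix_rfl
      have e1 : (FreeGroup.lift σ (FreeGroup.mk L)) ⟨1, h1⟩ = ⟨FreeGroup.mk L, hL⟩ :=
        Subtype.ext ih'
      obtain ⟨t, b⟩ := x
      have e2 : FreeGroup.mk ((t, b) :: L) = FreeGroup.mk [(t, b)] * FreeGroup.mk L := by
        rw [FreeGroup.mul_mk]; rfl
      rw [e2] at hx ⊢
      rw [map_mul, Equiv.Perm.mul_apply, e1]
      cases b with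
      | true =>
        change FreeGroup.of t * FreeGroup.mk L ∈ S at hx
        change ((FreeGroup.lift σ (FreeGroup.of t)) _ : FreeGroup α) = FreeGroup.of t * FreeGroup.mk L
        rw [FreeGroup.lift_apply_of, hσ t _ hL hx]
      | false =>
        have e3 : FreeGroup.mk [(t, false)] = (FreeGroup.of t)⁻¹ := rfl
        rw [e3] at hx ⊢
        rw [map_inv, FreeGroup.lift_apply_of]
        have : (σ t)⁻¹ ⟨FreeGroup.mk L, hL⟩ = ⟨(FreeGroup.of t)⁻¹ * FreeGroup.mk L, hx⟩ := by
          rw [Equiv.Perm.inv_eq_iff_eq, hσ t _ hx (by simpa using hL)]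
          simp
        rw [this]
  have key2 : ∀ w ∈ W, ((FreeGroup.lift σ w) ⟨1, h1⟩ : FreeGroup α) = w := by
    intro w hw
    have := key w.toWord fun L' hL' => by
      refine Finset.mem_insert_of_mem (Finset.mem_biUnion.2 ⟨w, hw, ?_⟩)
      rw [List.mem_toFinset, List.mem_map]
      exact ⟨L', (List.mem_tails _ _).2 hL', rfl⟩
    rwa [FreeGroup.mk_toWord] at this
  intro w hw w' hw' h
  rw [← key2 w hw, ← key2 w' hw', h]

section haagerup
variable {α : Type} [DecidableEq α]

lemma isReduced_invRev {L : List (α × Bool)} (h : FreeGroup.IsReduced L) :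
    FreeGroup.IsReduced (FreeGroup.invRev L) := by
  have : (FreeGroup.mk L)⁻¹.toWord = FreeGroup.invRev L := by
    rw [FreeGroup.toWord_inv, FreeGroup.toWord_mk, h.reduce_eq]
  rw [← this]; exact FreeGroup.isReduced_toWord

/-- indicator of a common prefix longer than `k` -/
def pre (k : ℕ) (w y : List (α × Bool)) : Prop :=
  k < w.length ∧ k < y.length ∧ w.take (k + 1) = y.take (k + 1)

instance (k : ℕ) (w y : List (α × Bool)) : Decidable (pre k w y) := by unfold pre; infer_instance

/-- partial sums of the kernel -/
noncomputable def gk (θ : ℝ) (n : ℕ) (w y : List (α × Bool)) : ℝ :=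
  1 + ∑ k ∈ Finset.range n, (θ⁻¹ ^ 2) ^ k * (θ⁻¹ ^ 2 - 1) * if pre k w y then 1 else 0

lemma gk_cons (θ : ℝ) (n : ℕ) (a : α × Bool) (w y : List (α × Bool)) :
    gk θ (n + 1) (a :: w) (a :: y) = θ⁻¹ ^ 2 * gk θ n w y := by
  unfold gk
  rw [Finset.sum_range_succ']
  have : ∀ k, (pre (k + 1) (a :: w) (a :: y)) ↔ pre k w y := by
    intro k; simp [pre]
  simp only [this]
  have h0 : pre 0 (a :: w) (a :: y) := by simp [pre]
  rw [if_pos h0, mul_add, Finset.mul_sum]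
  have : ∀ k, (θ⁻¹ ^ 2) ^ (k + 1) * (θ⁻¹ ^ 2 - 1) * (if pre k w y then (1:ℝ) else 0) =
    θ⁻¹ ^ 2 * ((θ⁻¹ ^ 2) ^ k * (θ⁻¹ ^ 2 - 1) * (if pre k w y then (1:ℝ) else 0)) := by
    intro k; ring
  simp only [this]; ring

lemma gk_eq_one (θ : ℝ) (n : ℕ) (w y : List (α × Bool)) (h : ∀ k, ¬ pre k w y) :
    gk θ n w y = 1 := by
  simp [gk, h]

lemma norm_mk_red {L : List (α × Bool)} (h : FreeGroup.IsReduced L) :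
    (FreeGroup.mk L).norm = L.length := by
  rw [FreeGroup.norm, FreeGroup.toWord_mk, h.reduce_eq]

lemma gk_norm (θ : ℝ) (hθ : 0 < θ) (w : List (α × Bool)) : ∀ (y : List (α × Bool)),
    FreeGroup.IsReduced w → FreeGroup.IsReduced y → ∀ n, w.length ≤ n →
    θ ^ ((FreeGroup.mk w)⁻¹ * FreeGroup.mk y).norm = θ ^ w.length * θ ^ y.length * gk θ n w y := by
  induction w with
  | nil =>
    intro y _ hy n _
    rw [gk_eq_one _ _ _ _ (by simp [pre]), ← FreeGroup.one_eq_mk, inv_one, one_mul, norm_mk_red hy]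
    simp
  | cons a w ih =>
    intro y hw hy n hn
    cases y with
    | nil =>
      rw [gk_eq_one _ _ _ _ (by simp [pre]), ← FreeGroup.one_eq_mk, mul_one, FreeGroup.norm_inv_eq,
        norm_mk_red hw]
      simp
    | cons b y =>
      have hw' : FreeGroup.IsReduced w := List.IsChain.tail hw
      have hy' : FreeGroup.IsReduced y := List.IsChain.tail hy
      by_cases hab : a = b
      · subst hab
        obtain ⟨m, rfl⟩ : ∃ m, n = m + 1 := ⟨n - 1, by simp at hn; omega⟩
        have e : (FreeGroup.mk (a :: w))⁻¹ * FreeGroup.mk (a :: y) =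
            (FreeGroup.mk w)⁻¹ * FreeGroup.mk y := by
          have e1 : ∀ L, FreeGroup.mk (a :: L) = FreeGroup.mk [a] * FreeGroup.mk L := fun L => by
            rw [FreeGroup.mul_mk]; rfl
          rw [e1 w, e1 y]; group
        rw [e, gk_cons, ih y hw' hy' m (by simpa using hn)]
        simp only [List.length_cons]
        field_simp
        ring
      · rw [gk_eq_one _ _ _ _ (by simp [pre, hab]), FreeGroup.inv_mk, FreeGroup.mul_mk, norm_mk_red]
        · simp [pow_add]
        · refine List.isChain_append.2 ⟨isReduced_invRev hw, hy, ?_⟩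
          rw [FreeGroup.invRev_cons]
          intro x hx z hz
          simp [FreeGroup.invRev] at hx hz
          subst hx; subst hz
          intro h
          simp only at h ⊢
          by_contra h2
          exact hab (Prod.ext h (by cases h3 : a.2 <;> cases h4 : b.2 <;> simp_all))

lemma psd_pre (k : ℕ) : (Matrix.of fun w y : List (α × Bool) => 
    if pre k w y then (1 : ℂ) else 0).PosSemidef := by
  have h1 := psd_eq (fun w : List (α × Bool) => w.take (k + 1))
  have h2 := psd_gram (fun w : List (α × Bool) => if k < w.length then (1 : ℂ) else 0)
  have := psd_mul h1 h2
  convert this using 1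
  ext w y
  by_cases h3 : k < w.length <;> by_cases h4 : k < y.length <;> simp [pre, h3, h4]

lemma psd_gk (θ : ℝ) (hθ : 0 < θ) (hθ1 : θ ≤ 1) (n : ℕ) : (Matrix.of fun w y : List (α × Bool) => 
    ((gk θ n w y : ℝ) : ℂ)).PosSemidef := by
  have h1 := psd_gram (fun w : List (α × Bool) => (1 : ℂ))
  have h2 : ∀ k ∈ Finset.range n, ((((θ⁻¹ ^ 2) ^ k * (θ⁻¹ ^ 2 - 1) : ℝ) : ℂ) •
      (Matrix.of fun w y : List (α × Bool) => if pre k w y then (1 : ℂ) else 0)).PosSemidef := by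
    intro k _
    refine (psd_pre k).smul ?_
    have : 1 ≤ θ⁻¹ ^ 2 := one_le_pow₀ ((one_le_inv₀ hθ).2 hθ1)
    have : 0 ≤ θ⁻¹ ^ 2 - 1 := by linarith
    exact_mod_cast (by positivity : 0 ≤ (θ⁻¹ ^ 2) ^ k * (θ⁻¹ ^ 2 - 1))
  have := h1.add (Matrix.posSemidef_sum _ h2)
  convert this using 1
  ext w y
  simp only [Matrix.of_apply, gk, Matrix.add_apply, Matrix.sum_apply, Matrix.smul_apply]
  push_cast
  simp only [RCLike.inner_apply, map_one, mul_one, smul_eq_mul]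
  congr 1
  refine Finset.sum_congr rfl fun k _ => ?_
  split_ifs <;> simp

lemma psd_haagerup (θ : ℝ) (hθ : 0 < θ) (hθ1 : θ ≤ 1) :
    (Matrix.of fun r s : FreeGroup α => ((θ ^ (r⁻¹ * s).norm : ℝ) : ℂ)).PosSemidef := by
  refine herm_of_form _ fun c => ?_
  let n := c.support.sup FreeGroup.norm
  have h1 := (psd_gk (α := α) θ hθ hθ1 n).submatrix FreeGroup.toWord
  have h2 := psd_gram (fun w : FreeGroup α => ((θ ^ w.norm : ℝ) : ℂ))
  have h3 := (h1.hadamard h2).2 c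
  convert h3 using 1
  refine Finset.sum_congr rfl fun r hr => Finset.sum_congr rfl fun s hs => ?_
  have := gk_norm θ hθ r.toWord s.toWord FreeGroup.isReduced_toWord FreeGroup.isReduced_toWord n
    (Finset.le_sup (f := FreeGroup.norm) hr)
  rw [FreeGroup.mk_toWord, FreeGroup.mk_toWord] at this
  simp only [Matrix.of_apply, this, Matrix.hadamard_apply, Matrix.submatrix_apply]
  simp [FreeGroup.norm]
  ring_nf
  simp

lemma norm_ge_two (deg : FreeGroup α →* Multiplicative ℤ)
    (hdeg : ∀ a, deg (FreeGroup.of a) = Multiplicative.ofAdd 1) (u : FreeGroup α)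
    (hu : deg u = Multiplicative.ofAdd 1) (hu' : ∀ a, u ≠ FreeGroup.of a) : 2 ≤ u.norm := by
  by_contra h
  have h' : u.toWord.length < 2 := by simpa [FreeGroup.norm] using h
  have e : FreeGroup.mk u.toWord = u := FreeGroup.mk_toWord
  match hL : u.toWord with
  | [] =>
    rw [FreeGroup.toWord_eq_nil_iff] at hL
    rw [hL, map_one] at hu
    exact absurd hu (by decide)
  | [(a, true)] => rw [hL] at e; exact hu' a e.symm
  | [(a, false)] =>
    rw [hL] at e
    have e3 : u = (FreeGroup.of a)⁻¹ := e.symm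
    rw [e3, map_inv, hdeg] at hu
    exact absurd hu (by decide)
  | _ :: _ :: _ => rw [hL] at h'; simp at h'

end haagerup
end SidonU

open scoped InnerProductSpace ComplexConjugate ComplexOrder

namespace SidonU

section
open scoped MatrixOrder Matrix.Norms.L2Operator
lemma psd_factor {n : Type} [Fintype n] (K : Matrix n n ℂ) (hK : K.PosSemidef) :
    ∃ R : Matrix n n ℂ, K = R.conjTranspose * R := by
  classical
  have h : 0 ≤ K := Matrix.nonneg_iff_posSemidef.2 hK
  obtain ⟨R, hR⟩ := (CStarAlgebra.nonneg_iff_eq_star_mul_self).1 h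
  exact ⟨R, hR⟩
end

/-- sesquilinear form of a scalar matrix on vectors -/
noncomputable def qf {n H : Type} [Fintype n] [NormedAddCommGroup H] [InnerProductSpace ℂ H]
    (M : Matrix n n ℂ) (ξ η : n → H) : ℂ := ∑ i, ∑ j, M i j * ⟪ξ i, η j⟫_ℂ

/-- action of a scalar matrix on vectors -/
noncomputable def mv {n H : Type} [Fintype n] [NormedAddCommGroup H] [InnerProductSpace ℂ H]
    (S : Matrix n n ℂ) (ξ : n → H) : n → H := fun i => ∑ k, S i k • ξ k

section
variable {n H : Type} [Fintype n] [NormedAddCommGroup H] [InnerProductSpace ℂ H]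

lemma qf_add (M N : Matrix n n ℂ) (ξ η : n → H) : qf (M + N) ξ η = qf M ξ η + qf N ξ η := by
  simp [qf, add_mul, Finset.sum_add_distrib]

lemma qf_smul (c : ℂ) (M : Matrix n n ℂ) (ξ η : n → H) : qf (c • M) ξ η = c * qf M ξ η := by
  simp [qf, Finset.mul_sum, mul_assoc]

lemma qf_one [DecidableEq n] (ξ η : n → H) : qf (1 : Matrix n n ℂ) ξ η = ∑ i, ⟪ξ i, η i⟫_ℂ := by
  simp [qf, Matrix.one_apply]

lemma qf_one_self [DecidableEq n] (ξ : n → H) :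
    qf (1 : Matrix n n ℂ) ξ ξ = ((∑ i, ‖ξ i‖ ^ 2 : ℝ) : ℂ) := by
  rw [qf_one]; simp [inner_self_eq_norm_sq_to_K]

lemma qf_conj (M : Matrix n n ℂ) (ξ : n → H) : qf M.conjTranspose ξ ξ = conj (qf M ξ ξ) := by
  simp only [qf, map_sum, map_mul, inner_conj_symm, Matrix.conjTranspose_apply]
  rw [Finset.sum_comm]; rfl

lemma qf_mv (S M T : Matrix n n ℂ) (ξ η : n → H) :
    qf (S.conjTranspose * M * T) ξ η = qf M (mv S ξ) (mv T η) := by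
  have e : qf M (mv S ξ) (mv T η) = ∑ i, ∑ j, ∑ k, ∑ l,
      conj (S i k) * M i j * T j l * ⟪ξ k, η l⟫_ℂ := by
    unfold qf mv
    refine Finset.sum_congr rfl fun i _ => Finset.sum_congr rfl fun j _ => ?_
    rw [sum_inner, Finset.mul_sum]
    refine Finset.sum_congr rfl fun k _ => ?_
    rw [inner_sum, Finset.mul_sum]
    refine Finset.sum_congr rfl fun l _ => ?_
    rw [inner_smul_left, inner_smul_right]; ring
  rw [e]
  unfold qf
  simp only [Matrix.mul_apply, Finset.sum_mul, Matrix.conjTranspose_apply]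
  have e2 : ∀ g : n → n → n → n → ℂ, ∑ i, ∑ j, ∑ k, ∑ l, g i j k l =
      ∑ k, ∑ l, ∑ j, ∑ i, g i j k l := by
    intro g
    calc _ = ∑ i, ∑ k, ∑ j, ∑ l, g i j k l := 
          Finset.sum_congr rfl fun i _ => Finset.sum_comm
      _ = ∑ k, ∑ i, ∑ j, ∑ l, g i j k l := Finset.sum_comm
      _ = ∑ k, ∑ i, ∑ l, ∑ j, g i j k l := 
          Finset.sum_congr rfl fun k _ => Finset.sum_congr rfl fun i _ => Finset.sum_comm
      _ = ∑ k, ∑ l, ∑ i, ∑ j, g i j k l := Finset.sum_congr rfl fun k _ => Finset.sum_comm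
      _ = _ := Finset.sum_congr rfl fun k _ => Finset.sum_congr rfl fun l _ => Finset.sum_comm
  exact (e2 _).symm

lemma mv_mul (S T : Matrix n n ℂ) (ξ : n → H) : mv S (mv T ξ) = mv (S * T) ξ := by
  funext i
  simp only [mv, Finset.smul_sum, smul_smul, Matrix.mul_apply, Finset.sum_smul]
  rw [Finset.sum_comm]

lemma mv_one [DecidableEq n] (ξ : n → H) : mv (1 : Matrix n n ℂ) ξ = ξ := by
  funext i
  simp [mv, Matrix.one_apply]

end

lemma herm_factor {n : Type} [Fintype n] [DecidableEq n] (L : Matrix n n ℂ)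
    (hL : ∀ ξ : n → ℂ, 0 ≤ (qf L ξ ξ).re) (δ : ℝ) (hδ : 0 < δ) :
    ∃ R S : Matrix n n ℂ, S * R = 1 ∧ R * S = 1 ∧ ∀ (H : Type) [NormedAddCommGroup H]
      [InnerProductSpace ℂ H] (ξ : n → H),
      ∑ k, ‖mv R ξ k‖ ^ 2 = (qf L ξ ξ).re + δ * ∑ i, ‖ξ i‖ ^ 2 := by
  let K : Matrix n n ℂ := (1 / 2 : ℂ) • (L + L.conjTranspose)
  have hK : ∀ (H : Type) [NormedAddCommGroup H] [InnerProductSpace ℂ H] (ξ : n → H),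
      qf K ξ ξ = (((qf L ξ ξ).re : ℝ) : ℂ) := by
    intro H _ _ ξ
    rw [qf_smul, qf_add, qf_conj, Complex.add_conj]
    push_cast; ring
  have hKh : K.IsHermitian := by
    simp only [K, Matrix.IsHermitian, Matrix.conjTranspose_smul, Matrix.conjTranspose_add,
      Matrix.conjTranspose_conjTranspose]
    rw [add_comm]; simp
  have hKp : K.PosSemidef := by
    refine Matrix.PosSemidef.of_dotProduct_mulVec_nonneg hKh fun ξ => ?_
    have : star ξ ⬝ᵥ K.mulVec ξ = qf K ξ ξ := by
      simp only [dotProduct, Matrix.mulVec, qf, Finset.mul_sum, RCLike.inner_apply, Pi.star_apply]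
      refine Finset.sum_congr rfl fun i _ => Finset.sum_congr rfl fun j _ => ?_
      simp only [RCLike.star_def]; ring
    rw [this, hK]
    exact_mod_cast hL ξ
  have hd : (K + (δ : ℂ) • 1).PosDef :=
    Matrix.PosDef.posSemidef_add hKp (Matrix.PosDef.one.smul (by exact_mod_cast hδ))
  obtain ⟨R, hR⟩ := psd_factor _ hd.posSemidef
  have hdet : IsUnit R.det := by
    have h1 := hd.det_pos.ne'
    rw [hR, Matrix.det_mul] at h1
    exact isUnit_iff_ne_zero.2 (right_ne_zero_of_mul h1)
  refine ⟨R, R⁻¹, Matrix.nonsing_inv_mul _ hdet, Matrix.mul_nonsing_inv _ hdet, ?_⟩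
  intro H _ _ ξ
  have e : qf (K + (δ : ℂ) • 1) ξ ξ = ((∑ k, ‖mv R ξ k‖ ^ 2 : ℝ) : ℂ) := by
    rw [hR, ← qf_one_self, ← qf_mv, Matrix.mul_one]
  rw [qf_add, hK, qf_smul, qf_one_self] at e
  exact_mod_cast e.symm

lemma opform_eq {G n H : Type} [Fintype n] [NormedAddCommGroup H] [InnerProductSpace ℂ H]
    (A : G →₀ Matrix n n ℂ) (v : G → H →L[ℂ] H) (ξ η : n → H) :
    opform A v ξ η = A.sum fun t M => qf M ξ (fun j => v t (η j)) := rfl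

lemma mv_map {n H : Type} [Fintype n] [NormedAddCommGroup H] [InnerProductSpace ℂ H]
    (T : Matrix n n ℂ) (v : H →L[ℂ] H) (η : n → H) :
    mv T (fun j => v (η j)) = fun j => v (mv T η j) := by
  funext i; simp [mv]

lemma opform_mv {G n H : Type} [Fintype n] [NormedAddCommGroup H] [InnerProductSpace ℂ H]
    (A : G →₀ Matrix n n ℂ) (S T : Matrix n n ℂ) (v : G → H →L[ℂ] H) (ξ η : n → H) :
    opform (A.mapRange (fun M => S.conjTranspose * M * T) (by simp)) v ξ η =
      opform A v (mv S ξ) (mv T η) := by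
  rw [opform_eq, Finsupp.sum_mapRange_index (by simp [qf]), opform_eq]
  refine Finsupp.sum_congr fun t _ => ?_
  rw [qf_mv, mv_map]

/-- vectors as Euclidean vectors -/
noncomputable abbrev eu {n m : Type} [Fintype m] (ξ : n → m → ℂ) : n → EuclideanSpace ℂ m :=
  fun i => WithLp.toLp 2 (ξ i)

lemma mform_eq_op {G n m : Type} [Fintype n] [Fintype m] [DecidableEq m]
    (A : G →₀ Matrix n n ℂ) (y : G → Matrix m m ℂ) (ξ η : n → m → ℂ) :
    mform A y ξ η = opform A (fun t => Matrix.toEuclideanCLM (𝕜 := ℂ) (y t)) (eu ξ) (eu η) := by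
  unfold mform opform
  refine Finsupp.sum_congr fun t _ => ?_
  refine Finset.sum_congr rfl fun i _ => Finset.sum_congr rfl fun j _ => ?_
  rw [inner_toEuclideanCLM']

lemma CSpos {G n m : Type} [Group G] [Fintype n] [Fintype m] (Λ : Set G) (C : ℝ) (hC : 0 ≤ C)
    (hCS : CSm Λ C) (L M : Matrix n n ℂ) (A : G →₀ Matrix n n ℂ) (hA : ∀ t, t ∉ Λ → A t = 0)
    (hpos : ∀ (H' : Type) [NormedAddCommGroup H'] [InnerProductSpace ℂ H'] [CompleteSpace H']
      (π : G →* unitary (H' →L[ℂ] H')) (ξ η : n → H'),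
      0 ≤ (qf L ξ ξ + qf M η η + opform A (fun t => (π t : H' →L[ℂ] H')) ξ η).re)
    (y : G → Matrix m m ℂ) (hy : ∀ t ∈ Λ, IsContr 1 (y t)) (ξ η : n → m → ℂ) :
    0 ≤ (C * qf L (eu ξ) (eu ξ) + C * qf M (eu η) (eu η) + mform A y ξ η).re := by
  classical
  have hL : ∀ ξ : n → ℂ, 0 ≤ (qf L ξ ξ).re := fun ξ => by
    have := hpos ℂ 1 ξ 0
    simpa [opform, qf] using this
  have hM : ∀ ξ : n → ℂ, 0 ≤ (qf M ξ ξ).re := fun ξ => by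
    have := hpos ℂ 1 0 ξ
    simpa [opform, qf] using this
  have key : ∀ δ : ℝ, 0 < δ → 0 ≤ C * ((qf L (eu ξ) (eu ξ)).re + δ * ∑ i, ‖eu ξ i‖ ^ 2) +
      C * ((qf M (eu η) (eu η)).re + δ * ∑ i, ‖eu η i‖ ^ 2) + (mform A y ξ η).re := by
    intro δ hδ
    obtain ⟨R, S, hSR, hRS, hR⟩ := herm_factor L hL δ hδ
    obtain ⟨R', S', hSR', hRS', hR'⟩ := herm_factor M hM δ hδ
    let b : G →₀ Matrix n n ℂ := A.mapRange (fun M => S.conjTranspose * M * S') (by simp)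
    have hb : RepBd b 2 := by
      intro H' _ _ _ π ξ η
      rw [opform_mv]
      have h := hpos H' π (-(mv S ξ)) (mv S' η)
      have h1 := hR H' (mv S ξ)
      have h2 := hR' H' (mv S' η)
      rw [mv_mul, hRS, mv_one] at h1
      rw [mv_mul, hRS', mv_one] at h2
      have e1 : qf L (-(mv S ξ)) (-(mv S ξ)) = qf L (mv S ξ) (mv S ξ) := by simp [qf]
      have e2 : opform A (fun t => (π t : H' →L[ℂ] H')) (-(mv S ξ)) (mv S' η) =
          - opform A (fun t => (π t : H' →L[ℂ] H')) (mv S ξ) (mv S' η) := by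
        simp [opform, Finsupp.sum]
      rw [e1, e2] at h
      simp only [Complex.add_re, Complex.neg_re] at h
      have p1 : 0 ≤ δ * ∑ i, ‖mv S ξ i‖ ^ 2 := by positivity
      have p2 : 0 ≤ δ * ∑ i, ‖mv S' η i‖ ^ 2 := by positivity
      linarith
    have h := hCS n b (fun t ht => by simp [b, hA t ht]) 2 (by norm_num) hb m y hy
      (fun i a => -(mv R (eu ξ) i) a) (fun i a => (mv R' (eu η) i) a)
    have eqe : ∀ ζ : EuclideanSpace ℂ m, ∑ a, ‖ζ a‖ ^ 2 = ‖ζ‖ ^ 2 := fun ζ =>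
      (EuclideanSpace.norm_sq_eq ζ).symm
    simp only [norm_neg, eqe, hR, hR'] at h
    rw [mform_eq_op, opform_mv] at h
    have e3 : eu (fun i a => -(mv R (eu ξ) i) a) = - mv R (eu ξ) := by
      funext i; rfl
    have e4 : eu (fun i a => (mv R' (eu η) i) a) = mv R' (eu η) := by
      funext i; rfl
    have e5 : mv S (- mv R (eu ξ)) = - eu ξ := by
      have : mv S (- mv R (eu ξ)) = - mv S (mv R (eu ξ)) := by funext i; simp [mv]
      rw [this, mv_mul, hSR, mv_one]
    rw [e3, e4, e5, mv_mul, hSR', mv_one] at h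
    have e6 : opform A (fun t => Matrix.toEuclideanCLM (𝕜 := ℂ) (y t)) (-(eu ξ)) (eu η) =
          - mform A y ξ η := by
        rw [mform_eq_op]
        simp [opform, Finsupp.sum]
    rw [e6, Complex.neg_re] at h
    linarith
  have e : (C * qf L (eu ξ) (eu ξ) + C * qf M (eu η) (eu η) + mform A y ξ η).re =
      C * (qf L (eu ξ) (eu ξ)).re + C * (qf M (eu η) (eu η)).re + (mform A y ξ η).re := by
    simp
  rw [e]
  refine le_of_forall_pos_le_add fun ε hε => ?_
  set q : ℝ := C * ∑ i, ‖eu ξ i‖ ^ 2 + C * ∑ i, ‖eu η i‖ ^ 2 with hq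
  have hq0 : 0 ≤ q := by positivity
  have := key (ε / (q + 1)) (by positivity)
  have h3 : ε / (q + 1) * q ≤ ε := by
    rw [div_mul_eq_mul_div, div_le_iff₀ (by positivity)]
    nlinarith
  nlinarith

end SidonU

open scoped InnerProductSpace ComplexConjugate ComplexOrder

namespace SidonU

/-- index type -/
abbrev Idx (F G κ : Type) := (F × G) × (κ ⊕ κ) × (κ ⊕ κ)

/-- allowed indices -/
def Allowed {F G κ : Type} [Group G] (Λ : Set G) : Idx F G κ → Prop
  | (γ, .inl _, .inl _) => γ.2 = 1
  | (γ, .inr _, .inr _) => γ.2 = 1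
  | (γ, .inl _, .inr _) => γ.2 ∈ Λ
  | (_, .inr _, .inl _) => False

open Classical in
/-- prescribed values -/
noncomputable def Psi0 {F G κ : Type} [Group F] (ge : G → F) (C : ℝ) (x : G → Matrix κ κ ℂ) :
    Idx F G κ → ℂ
  | (γ, .inl a, .inl b) => if γ.1 = 1 ∧ a = b then C else 0
  | (γ, .inr a, .inr b) => if γ.1 = 1 ∧ a = b then C else 0
  | (γ, .inl a, .inr b) => if γ.1 = ge γ.2 then x γ.2 a b else 0
  | (_, .inr _, .inl _) => 0

/-- weights -/
noncomputable def wt {F G κ Q H : Type} [Group F] [Group G] [Group Q] [Fintype Q]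
    [NormedAddCommGroup H] [InnerProductSpace ℂ H] [CompleteSpace H]
    (q : F →* Q) (π : G →* unitary (H →L[ℂ] H)) (ξ : κ ⊕ κ → Q → H) (I : Idx F G κ) : ℂ :=
  ∑ z, ⟪ξ I.2.1 (q I.1.1 * z), (π I.1.2 : H →L[ℂ] H) (ξ I.2.2 z)⟫_ℂ

/-- positivity -/
def Pos {F G κ : Type} [Group F] [Group G] (x : Idx F G κ →₀ ℂ) : Prop :=
  ∀ (Q : Type) [Group Q] [Fintype Q] (q : F →* Q) (H : Type) [NormedAddCommGroup H]
    [InnerProductSpace ℂ H] [CompleteSpace H] (π : G →* unitary (H →L[ℂ] H)) (ξ : κ ⊕ κ → Q → H),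
    0 ≤ (Finsupp.linearCombination ℂ (wt q π ξ) x).re

section
variable {κ Q : Type} [Fintype κ] [DecidableEq κ] [Group Q] [Fintype Q] [DecidableEq Q]

/-- shift matrix units -/
noncomputable def sh (w : Q) (a b : κ) : Matrix (κ × Q) (κ × Q) ℂ :=
  ∑ z, Matrix.single (a, w * z) (b, z) 1

lemma qf_sh {H : Type} [NormedAddCommGroup H] [InnerProductSpace ℂ H] (w : Q) (a b : κ)
    (ξ η : κ × Q → H) : qf (sh w a b) ξ η = ∑ z, ⟪ξ (a, w * z), η (b, z)⟫_ℂ := by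
  have h0 : ∀ i j : κ × Q, qf (Matrix.single i j (1 : ℂ)) ξ η = ⟪ξ i, η j⟫_ℂ := by
    intro i j
    unfold qf
    rw [Finset.sum_eq_single i, Finset.sum_eq_single j]
    · simp
    · intro k _ hk; simp [Matrix.single, hk.symm]
    · simp
    · intro k _ hk; simp [Matrix.single, hk.symm]
    · simp
  have h1 : ∀ s : Finset Q, qf (∑ z ∈ s, Matrix.single (a, w * z) (b, z) (1 : ℂ)) ξ η =
      ∑ z ∈ s, ⟪ξ (a, w * z), η (b, z)⟫_ℂ := by
    intro s
    induction s using Finset.induction_on with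
    | empty => simp [qf]
    | insert z s hz ih => rw [Finset.sum_insert hz, Finset.sum_insert hz, qf_add, ih, h0]
  exact h1 _

variable {F G : Type} [Group F] [Group G]

/-- left block -/
noncomputable def eL (q : F →* Q) : Idx F G κ → Matrix (κ × Q) (κ × Q) ℂ
  | (γ, .inl a, .inl b) => sh (q γ.1) a b
  | _ => 0
/-- right block -/
noncomputable def eM (q : F →* Q) : Idx F G κ → Matrix (κ × Q) (κ × Q) ℂ
  | (γ, .inr a, .inr b) => sh (q γ.1) a b
  | _ => 0
/-- off-diagonal block -/
noncomputable def eA (q : F →* Q) : Idx F G κ → Matrix (κ × Q) (κ × Q) ℂ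
  | (γ, .inl a, .inr b) => sh (q γ.1) a b
  | _ => 0

lemma qf_zero {n H : Type} [Fintype n] [NormedAddCommGroup H] [InnerProductSpace ℂ H]
    (ξ η : n → H) : qf (0 : Matrix n n ℂ) ξ η = 0 := by simp [qf]

lemma qf_fsum {X n H : Type} [Fintype n] [NormedAddCommGroup H] [InnerProductSpace ℂ H]
    (x : X →₀ ℂ) (e : X → Matrix n n ℂ) (ξ η : n → H) :
    qf (x.sum fun I c => c • e I) ξ η = x.sum fun I c => c * qf (e I) ξ η := by
  unfold Finsupp.sum
  have h1 : ∀ s : Finset X, qf (∑ I ∈ s, x I • e I) ξ η = ∑ I ∈ s, x I * qf (e I) ξ η := by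
    classical
    intro s
    induction s using Finset.induction_on with
    | empty => simp [qf]
    | insert z s hz ih => rw [Finset.sum_insert hz, Finset.sum_insert hz, qf_add, ih, qf_smul]
  exact h1 _

lemma opform_add {G : Type} {n H : Type} [Fintype n] [NormedAddCommGroup H] [InnerProductSpace ℂ H]
    (A B : G →₀ Matrix n n ℂ) (v : G → H →L[ℂ] H) (ξ η : n → H) :
    opform (A + B) v ξ η = opform A v ξ η + opform B v ξ η := by
  classical
  simp only [opform_eq]
  exact Finsupp.sum_add_index' (fun _ => qf_zero _ _) (fun _ _ _ => qf_add _ _ _ _)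

lemma opform_fsum {G : Type} {X n H : Type} [Fintype n] [NormedAddCommGroup H] [InnerProductSpace ℂ H]
    (x : X →₀ ℂ) (gg : X → G) (e : X → Matrix n n ℂ) (v : G → H →L[ℂ] H) (ξ η : n → H) :
    opform (x.sum fun I c => Finsupp.single (gg I) (c • e I)) v ξ η =
      x.sum fun I c => c * qf (e I) ξ (fun j => v (gg I) (η j)) := by
  unfold Finsupp.sum
  have h1 : ∀ s : Finset X, opform (∑ I ∈ s, Finsupp.single (gg I) (x I • e I)) v ξ η =
      ∑ I ∈ s, x I * qf (e I) ξ (fun j => v (gg I) (η j)) := by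
    classical
    intro s
    induction s using Finset.induction_on with
    | empty => simp [opform]
    | insert z s hz ih =>
      rw [Finset.sum_insert hz, Finset.sum_insert hz, opform_add, ih, opform_eq,
        Finsupp.sum_single_index (h := fun t M => qf M ξ fun j => v t (η j)) (qf_zero _ _), qf_smul]
  exact h1 _

lemma wt_eq {H : Type} [NormedAddCommGroup H] [InnerProductSpace ℂ H] [CompleteSpace H]
    (Λ : Set G) (q : F →* Q) (π : G →* unitary (H →L[ℂ] H)) (ξ : κ ⊕ κ → Q → H) (I : Idx F G κ)
    (hI : Allowed Λ I) :
    wt q π ξ I = qf (eL q I) (fun p => ξ (.inl p.1) p.2) (fun p => ξ (.inl p.1) p.2) +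
      qf (eM q I) (fun p => ξ (.inr p.1) p.2) (fun p => ξ (.inr p.1) p.2) +
      qf (eA q I) (fun p => ξ (.inl p.1) p.2)
        (fun p => (π I.1.2 : H →L[ℂ] H) (ξ (.inr p.1) p.2)) := by
  obtain ⟨⟨u, g⟩, a | a, b | b⟩ := I
  · have hg : g = 1 := hI
    subst hg
    simp [wt, eL, eM, eA, qf_sh, qf_zero]
  · simp [wt, eL, eM, eA, qf_sh, qf_zero]
  · exact hI.elim
  · have hg : g = 1 := hI
    subst hg
    simp [wt, eL, eM, eA, qf_sh, qf_zero]

lemma contr_shift (X : Matrix κ κ ℂ) (hX : IsContr 1 X) (w : Q) :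
    IsContr 1 (Matrix.of fun p r : κ × Q => if p.2 = w * r.2 then X p.1 r.1 else 0) := by
  intro v v'
  have e : (∑ p, ∑ r, conj (v p) * (Matrix.of fun p r : κ × Q =>
      if p.2 = w * r.2 then X p.1 r.1 else 0) p r * v' r) =
      ∑ z, ∑ a, ∑ b, conj (v (a, w * z)) * X a b * v' (b, z) := by
    rw [Finset.sum_comm, Fintype.sum_prod_type_right]
    refine Finset.sum_congr rfl fun z _ => ?_
    rw [Finset.sum_comm]
    rw [Fintype.sum_prod_type]
    refine Finset.sum_congr rfl fun a _ => ?_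
    rw [Finset.sum_comm]
    refine Finset.sum_congr rfl fun b _ => ?_
    rw [Finset.sum_eq_single (w * z)]
    · simp
    · intro z' _ hz'; simp [hz']
    · simp
  rw [e, Complex.re_sum]
  have e2 : ∑ p, ‖v p‖ ^ 2 = ∑ z, ∑ a, ‖v (a, w * z)‖ ^ 2 := by
    rw [Fintype.sum_prod_type_right]
    exact (Equiv.sum_comp (Equiv.mulLeft w) (fun z => ∑ a, ‖v (a, z)‖ ^ 2)).symm
  rw [e2, Fintype.sum_prod_type_right (f := fun p => ‖v' p‖ ^ 2), ← Finset.sum_add_distrib,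
    Finset.mul_sum]
  exact Finset.sum_le_sum fun z _ => hX _ _

end

lemma psi0_nonneg {F G κ : Type} [Group F] [Group G] [Fintype κ] (Λ : Set G) (C : ℝ) (hC : 0 ≤ C)
    (hCS : CSm Λ C) (ge : G → F)
    (hF : ∀ W : Finset F, ∃ (Q : Type) (_ : Group Q) (_ : Fintype Q) (q : F →* Q), Set.InjOn q W)
    (x : G → Matrix κ κ ℂ) (hx : ∀ t ∈ Λ, IsContr 1 (x t)) (c : Idx F G κ →₀ ℂ)
    (hc : ∀ I, ¬ Allowed Λ I → c I = 0) (hpos : Pos c) :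
    0 ≤ (Finsupp.linearCombination ℂ (Psi0 ge C x) c).re := by
  classical
  obtain ⟨Q, _, _, q, hq⟩ := hF (insert 1 (c.support.image (fun I => I.1.1) ∪
    c.support.image (fun I => ge I.1.2)))
  have hal : ∀ I ∈ c.support, Allowed Λ I := fun I hI => by
    by_contra h
    exact (Finsupp.mem_support_iff.1 hI) (hc I h)
  let L := c.sum fun I z => z • eL q I
  let M := c.sum fun I z => z • eM q I
  let A := c.sum fun I z => Finsupp.single I.1.2 (z • eA q I)
  let y : G → Matrix (κ × Q) (κ × Q) ℂ := fun g =>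
    Matrix.of fun p r : κ × Q => if p.2 = q (ge g) * r.2 then x g p.1 r.1 else 0
  have hA : ∀ t, t ∉ Λ → A t = 0 := by
    intro t ht
    simp only [A, Finsupp.sum, Finsupp.finsetSum_apply]
    refine Finset.sum_eq_zero fun I hI => ?_
    have := hal I hI
    obtain ⟨⟨u, g⟩, a | a, b | b⟩ := I
    · simp [eA]
    · have hg : g ∈ Λ := this
      have : g ≠ t := fun h => ht (h ▸ hg)
      simp [this]
    · simp [eA]
    · simp [eA]
  have := CSpos Λ C hC hCS L M A hA (by
    intro H' _ _ _ π ξ η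
    have h := hpos Q q H' π (fun α z => Sum.elim (fun a => ξ (a, z)) (fun a => η (a, z)) α)
    convert h using 2
    rw [qf_fsum, qf_fsum, opform_fsum, Finsupp.linearCombination_apply]
    unfold Finsupp.sum
    rw [← Finset.sum_add_distrib, ← Finset.sum_add_distrib]
    refine Finset.sum_congr rfl fun I hI => ?_
    beta_reduce
    rw [wt_eq Λ q π _ I (hal I hI), smul_eq_mul]
    simp only [Sum.elim_inl, Sum.elim_inr]
    ring) y (fun t ht => contr_shift _ (hx t ht) _)
    (fun i j => if i = j then 1 else 0) (fun i j => if i = j then 1 else 0)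
  have e : (C * qf L (eu fun i j => if i = j then 1 else 0) (eu fun i j => if i = j then 1 else 0) +
      C * qf M (eu fun i j => if i = j then 1 else 0) (eu fun i j => if i = j then 1 else 0) +
      mform A y (fun i j => if i = j then 1 else 0) (fun i j => if i = j then 1 else 0)) =
      (Fintype.card Q : ℂ) * Finsupp.linearCombination ℂ (Psi0 ge C x) c := by
    rw [mform_eq_op, qf_fsum, qf_fsum, opform_fsum, Finsupp.linearCombination_apply]
    unfold Finsupp.sum
    rw [Finset.mul_sum, Finset.mul_sum, Finset.mul_sum, ← Finset.sum_add_distrib,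
      ← Finset.sum_add_distrib]
    refine Finset.sum_congr rfl fun I hI => ?_
    have h1 := hal I hI
    have hu : I.1.1 ∈ ((insert 1 (c.support.image (fun I => I.1.1) ∪
      c.support.image (fun I => ge I.1.2)) : Finset F) : Set F) := by
      simp only [Finset.mem_coe, Finset.mem_insert, Finset.mem_union, Finset.mem_image]
      exact Or.inr (Or.inl ⟨I, hI, rfl⟩)
    have hg : ge I.1.2 ∈ ((insert 1 (c.support.image (fun I => I.1.1) ∪
      c.support.image (fun I => ge I.1.2)) : Finset F) : Set F) := by
      simp only [Finset.mem_coe, Finset.mem_insert, Finset.mem_union, Finset.mem_image]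
      exact Or.inr (Or.inr ⟨I, hI, rfl⟩)
    have h1m : (1 : F) ∈ ((insert 1 (c.support.image (fun I => I.1.1) ∪
      c.support.image (fun I => ge I.1.2)) : Finset F) : Set F) := by simp
    have q1 : q I.1.1 = 1 ↔ I.1.1 = 1 :=
      ⟨fun h => hq hu h1m (by rw [h, map_one]), fun h => by rw [h, map_one]⟩
    have q2 : q I.1.1 = q (ge I.1.2) ↔ I.1.1 = ge I.1.2 :=
      ⟨fun h => hq hu hg h, fun h => by rw [h]⟩
    clear hu hg h1m hq hI this
    have ie : ∀ i j : κ × Q, ⟪(WithLp.toLp 2 (fun l => if i = l then (1 : ℂ) else 0) :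
        EuclideanSpace ℂ (κ × Q)), WithLp.toLp 2 (fun l => if j = l then (1 : ℂ) else 0)⟫_ℂ =
        if i = j then 1 else 0 := by
      intro i j
      simp [PiLp.inner_apply, eq_comm]
    have ie2 : ∀ (Y : Matrix (κ × Q) (κ × Q) ℂ) (i j : κ × Q),
        ⟪(WithLp.toLp 2 (fun l => if i = l then (1 : ℂ) else 0) :
        EuclideanSpace ℂ (κ × Q)), Matrix.toEuclideanCLM (𝕜 := ℂ) Y 
          (WithLp.toLp 2 (fun l => if j = l then (1 : ℂ) else 0))⟫_ℂ = Y i j := by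
      intro Y i j
      rw [inner_toEuclideanCLM']
      simp
    obtain ⟨⟨u, g⟩, a | a, b | b⟩ := I
    · simp only [eL, eM, eA, qf_zero, qf_sh, eu, ie, Psi0, Prod.mk.injEq, mul_eq_right, q1] at *
      by_cases h2 : u = 1 <;> by_cases h3 : a = b <;> simp [h2, h3]; try ring
    · simp only [eL, eM, eA, qf_zero, qf_sh, eu, ie2, Psi0, y, Matrix.of_apply, mul_left_inj, q2]
      by_cases h2 : u = ge g <;> simp [h2]; try ring
    · exact h1.elim
    · simp only [eL, eM, eA, qf_zero, qf_sh, eu, ie, Psi0, Prod.mk.injEq, mul_eq_right, q1] at *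
      by_cases h2 : u = 1 <;> by_cases h3 : a = b <;> simp [h2, h3]; try ring
  rw [e] at this
  have h5 : 0 < (Fintype.card Q : ℝ) := by exact_mod_cast Fintype.card_pos
  have h6 : ((Fintype.card Q : ℂ) * Finsupp.linearCombination ℂ (Psi0 ge C x) c).re =
      (Fintype.card Q : ℝ) * (Finsupp.linearCombination ℂ (Psi0 ge C x) c).re := by
    rw [← Complex.ofReal_natCast, Complex.re_ofReal_mul]
  rw [h6] at this
  exact nonneg_of_mul_nonneg_right this h5

end SidonU

open scoped InnerProductSpace ComplexConjugate ComplexOrder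

namespace SidonU

section
variable {F G κ : Type} [Group F] [Group G]

/-- the cone of positive elements -/
noncomputable def PosCone (F G κ : Type) [Group F] [Group G] : PointedCone ℝ (Idx F G κ →₀ ℂ) where
  carrier := {x | Pos x}
  add_mem' := by
    intro x y hx hy Q _ _ q H _ _ _ π ξ
    rw [map_add, Complex.add_re]
    exact add_nonneg (hx Q q H π ξ) (hy Q q H π ξ)
  zero_mem' := by
    intro Q _ _ q H _ _ _ π ξ
    simp
  smul_mem' := by
    intro c x hx Q _ _ q H _ _ _ π ξ
    have e : c • x = ((c : ℝ) : ℂ) • x := by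
      ext I
      simp
    rw [e, map_smul, smul_eq_mul, Complex.re_ofReal_mul]
    exact mul_nonneg c.2 (hx Q q H π ξ)

/-- squares -/
noncomputable def sq (c : (F × G) × (κ ⊕ κ) →₀ ℂ) : Idx F G κ →₀ ℂ :=
  c.sum fun p z => c.sum fun r w => Finsupp.single (p.1⁻¹ * r.1, p.2, r.2) (star z * w)

lemma lc_sq (Φ : Idx F G κ → ℂ) (c : (F × G) × (κ ⊕ κ) →₀ ℂ) :
    Finsupp.linearCombination ℂ Φ (sq c) =
      c.sum fun p z => c.sum fun r w => star z * Φ (p.1⁻¹ * r.1, p.2, r.2) * w := by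
  unfold sq Finsupp.sum
  simp only [map_sum, Finsupp.linearCombination_single, smul_eq_mul]
  refine Finset.sum_congr rfl fun p _ => Finset.sum_congr rfl fun r _ => ?_
  ring

lemma wt_mul {Q H : Type} [Group Q] [Fintype Q]
    [NormedAddCommGroup H] [InnerProductSpace ℂ H] [CompleteSpace H]
    (q : F →* Q) (π : G →* unitary (H →L[ℂ] H)) (ξ : κ ⊕ κ → Q → H)
    (p r : (F × G) × (κ ⊕ κ)) :
    wt q π ξ (p.1⁻¹ * r.1, p.2, r.2) =
      ∑ z, ⟪(π p.1.2 : H →L[ℂ] H) (ξ p.2 ((q p.1.1)⁻¹ * z)),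
        (π r.1.2 : H →L[ℂ] H) (ξ r.2 ((q r.1.1)⁻¹ * z))⟫_ℂ := by
  unfold wt
  rw [← Equiv.sum_comp (Equiv.mulLeft (q r.1.1)⁻¹)]
  refine Finset.sum_congr rfl fun z _ => ?_
  simp only [Equiv.coe_mulLeft, Prod.fst_mul, Prod.fst_inv, Prod.snd_mul, Prod.snd_inv, map_mul,
    map_inv, mul_assoc, mul_inv_cancel_left]
  rw [← ContinuousLinearMap.adjoint_inner_right]
  congr 1

lemma lc_sq_wt {Q H : Type} [Group Q] [Fintype Q]
    [NormedAddCommGroup H] [InnerProductSpace ℂ H] [CompleteSpace H]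
    (q : F →* Q) (π : G →* unitary (H →L[ℂ] H)) (ξ : κ ⊕ κ → Q → H)
    (c : (F × G) × (κ ⊕ κ) →₀ ℂ) :
    ∃ r : ℝ, 0 ≤ r ∧ Finsupp.linearCombination ℂ (wt q π ξ) (sq c) = r := by
  refine ⟨∑ z, ‖c.sum fun p w => w • (π p.1.2 : H →L[ℂ] H) (ξ p.2 ((q p.1.1)⁻¹ * z))‖ ^ 2,
    Finset.sum_nonneg fun z _ => sq_nonneg _, ?_⟩
  rw [lc_sq]
  have hz : ∀ z, (((‖c.sum fun p w => w • (π p.1.2 : H →L[ℂ] H) (ξ p.2 ((q p.1.1)⁻¹ * z))‖ ^ 2 :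
      ℝ)) : ℂ) = ∑ p ∈ c.support, ∑ r ∈ c.support, star (c p) *
        ⟪(π p.1.2 : H →L[ℂ] H) (ξ p.2 ((q p.1.1)⁻¹ * z)),
        (π r.1.2 : H →L[ℂ] H) (ξ r.2 ((q r.1.1)⁻¹ * z))⟫_ℂ * c r := by
    intro z
    have h0 := inner_self_eq_norm_sq_to_K (𝕜 := ℂ)
      (c.sum fun p w => w • (π p.1.2 : H →L[ℂ] H) (ξ p.2 ((q p.1.1)⁻¹ * z)))
    have h1 : (((‖c.sum fun p w => w • (π p.1.2 : H →L[ℂ] H) (ξ p.2 ((q p.1.1)⁻¹ * z))‖ ^ 2 :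
      ℝ)) : ℂ) = _ := (by push_cast; exact h0.symm)
    rw [h1]
    unfold Finsupp.sum
    rw [sum_inner]
    refine Finset.sum_congr rfl fun p _ => ?_
    rw [inner_sum]
    refine Finset.sum_congr rfl fun r _ => ?_
    rw [inner_smul_left, inner_smul_right, Complex.star_def]
    ring
  rw [Complex.ofReal_sum, Finset.sum_congr rfl fun z _ => hz z, Finset.sum_comm]
  unfold Finsupp.sum
  refine Finset.sum_congr rfl fun p _ => ?_
  rw [Finset.sum_comm]
  refine Finset.sum_congr rfl fun r _ => ?_
  beta_reduce
  rw [wt_mul, Finset.mul_sum, Finset.sum_mul]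

lemma sq_pos (c : (F × G) × (κ ⊕ κ) →₀ ℂ) (w : ℂ) (hw : 0 ≤ w.re) : Pos (w • sq c) := by
  intro Q _ _ q H _ _ _ π ξ
  obtain ⟨r, hr, e⟩ := lc_sq_wt q π ξ c
  rw [map_smul, e, smul_eq_mul, mul_comm, Complex.re_ofReal_mul]
  exact mul_nonneg hr hw


lemma wt_bound [Fintype κ] {Q H : Type} [Group Q] [Fintype Q]
    [NormedAddCommGroup H] [InnerProductSpace ℂ H] [CompleteSpace H]
    (q : F →* Q) (π : G →* unitary (H →L[ℂ] H)) (ξ : κ ⊕ κ → Q → H) (I : Idx F G κ) :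
    ‖wt q π ξ I‖ ≤ ∑ α, ∑ z, ‖ξ α z‖ ^ 2 := by
  have hN : ∀ α, ∑ z, ‖ξ α z‖ ^ 2 ≤ ∑ α, ∑ z, ‖ξ α z‖ ^ 2 := fun α =>
    Finset.single_le_sum (f := fun α => ∑ z, ‖ξ α z‖ ^ 2)
      (fun _ _ => Finset.sum_nonneg fun _ _ => sq_nonneg _) (Finset.mem_univ α)
  have h1 : ‖wt q π ξ I‖ ≤ ∑ z, (1/2) * (‖ξ I.2.1 (q I.1.1 * z)‖ ^ 2 + ‖ξ I.2.2 z‖ ^ 2) := by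
    refine (norm_sum_le _ _).trans (Finset.sum_le_sum fun z _ => ?_)
    refine (norm_inner_le_norm _ _).trans ?_
    have : ‖(π I.1.2 : H →L[ℂ] H) (ξ I.2.2 z)‖ = ‖ξ I.2.2 z‖ :=
      Unitary.norm_map (π I.1.2) _
    rw [this]
    nlinarith [sq_nonneg (‖ξ I.2.1 (q I.1.1 * z)‖ - ‖ξ I.2.2 z‖)]
  refine h1.trans ?_
  rw [← Finset.mul_sum, Finset.sum_add_distrib]
  have h2 : ∑ z, ‖ξ I.2.1 (q I.1.1 * z)‖ ^ 2 = ∑ z, ‖ξ I.2.1 z‖ ^ 2 :=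
    Equiv.sum_comp (Equiv.mulLeft (q I.1.1)) (fun z => ‖ξ I.2.1 z‖ ^ 2)
  linarith [hN I.2.1, hN I.2.2]

lemma dense_aux [Fintype κ] (Λ : Set G) (y : Idx F G κ →₀ ℂ) :
    ∃ x : Idx F G κ →₀ ℂ, (∀ I, ¬ Allowed Λ I → x I = 0) ∧ Pos (x + y) := by
  classical
  refine ⟨∑ α : κ ⊕ κ, Finsupp.single ((1, 1), α, α) (((∑ I ∈ y.support, ‖y I‖ : ℝ)) : ℂ), ?_, ?_⟩
  · intro I hI
    rw [Finsupp.finsetSum_apply]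
    refine Finset.sum_eq_zero fun α _ => ?_
    rw [Finsupp.single_apply, if_neg]
    rintro rfl
    apply hI
    rcases α with a | a <;> rfl
  · intro Q _ _ q H _ _ _ π ξ
    have e1 : Finsupp.linearCombination ℂ (wt q π ξ) (∑ α : κ ⊕ κ, Finsupp.single ((1, 1), α, α)
        (((∑ I ∈ y.support, ‖y I‖ : ℝ)) : ℂ)) =
        (((∑ I ∈ y.support, ‖y I‖) * ∑ α, ∑ z, ‖ξ α z‖ ^ 2 : ℝ) : ℂ) := by
      rw [map_sum, Complex.ofReal_mul, Complex.ofReal_sum Finset.univ, Finset.mul_sum]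
      refine Finset.sum_congr rfl fun α _ => ?_
      rw [Finsupp.linearCombination_single, smul_eq_mul]
      congr 1
      simp [wt, inner_self_eq_norm_sq_to_K]
    rw [map_add, e1, Complex.add_re, Complex.ofReal_re]
    have h2 : ‖Finsupp.linearCombination ℂ (wt q π ξ) y‖ ≤
        (∑ I ∈ y.support, ‖y I‖) * ∑ α, ∑ z, ‖ξ α z‖ ^ 2 := by
      rw [Finsupp.linearCombination_apply, Finset.sum_mul]
      refine (norm_sum_le _ _).trans (Finset.sum_le_sum fun I _ => ?_)
      rw [norm_smul]
      exact mul_le_mul_of_nonneg_left (wt_bound q π ξ I) (norm_nonneg _)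
    have := (abs_le.1 ((Complex.abs_re_le_norm _).trans h2)).1
    linarith

lemma exists_Psi_aux [Fintype κ] (Λ : Set G) (C : ℝ) (hC : 0 ≤ C)
    (hCS : CSm Λ C) (ge : G → F)
    (hF : ∀ W : Finset F, ∃ (Q : Type) (_ : Group Q) (_ : Fintype Q) (q : F →* Q), Set.InjOn q W)
    (x : G → Matrix κ κ ℂ) (hx : ∀ t ∈ Λ, IsContr 1 (x t)) :
    ∃ Ψ : Idx F G κ → ℂ, (∀ I, Allowed Λ I → Ψ I = Psi0 ge C x I) ∧
      (Matrix.of fun p r : (F × G) × (κ ⊕ κ) => Ψ (p.1⁻¹ * r.1, p.2, r.2)).PosSemidef := by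
  classical
  let S : Submodule ℝ (Idx F G κ →₀ ℂ) :=
    { carrier := {c | ∀ I, ¬ Allowed Λ I → c I = 0}
      add_mem' := fun {a b} ha hb I hI => by simp [ha I hI, hb I hI]
      zero_mem' := fun I hI => rfl
      smul_mem' := fun r a ha I hI => by simp [ha I hI] }
  let f0 : (Idx F G κ →₀ ℂ) →ₗ[ℝ] ℝ :=
    Complex.reLm ∘ₗ (Finsupp.linearCombination ℂ (Psi0 ge C x)).restrictScalars ℝ
  let f : (Idx F G κ →₀ ℂ) →ₗ.[ℝ] ℝ := ⟨S, f0 ∘ₗ S.subtype⟩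
  obtain ⟨g, hg1, hg2⟩ := riesz_extension (PosCone F G κ) f
    (fun c hc => psi0_nonneg Λ C hC hCS ge hF x hx c.1 c.2 hc)
    (fun y => by
      obtain ⟨c, h1, h2⟩ := dense_aux Λ y
      exact ⟨⟨c, h1⟩, h2⟩)
  let L : (Idx F G κ →₀ ℂ) →ₗ[ℂ] ℂ := Module.Dual.extendRCLike (𝕜 := ℂ) g
  have hL : ∀ y, (L y).re = g y := fun y => Module.Dual.re_extendRCLike_apply (𝕜 := ℂ) g y
  have hgf : ∀ c, (∀ I, ¬ Allowed Λ I → c I = 0) →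
      g c = (Finsupp.linearCombination ℂ (Psi0 ge C x) c).re := fun c hc => hg1 ⟨c, hc⟩
  refine ⟨fun I => L (Finsupp.single I 1), ?_, ?_⟩
  · intro I hI
    have hs : ∀ w : ℂ, ∀ J, ¬ Allowed Λ J → Finsupp.single I w J = 0 := by
      intro w J hJ
      rw [Finsupp.single_apply, if_neg]
      rintro rfl
      exact hJ hI
    apply Complex.ext
    · rw [hL, hgf _ (hs 1)]
      simp
    · have h1 : (L (Complex.I • Finsupp.single I 1)).re = -(L (Finsupp.single I 1)).im := by
        rw [map_smul]; simp
      rw [hL, Finsupp.smul_single, smul_eq_mul, mul_one, hgf _ (hs _)] at h1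
      simp only [Finsupp.linearCombination_single, smul_eq_mul, Complex.I_mul_re] at h1
      linarith
  · apply herm_of_form
    intro c
    have hLs : L = Finsupp.linearCombination ℂ (fun I => L (Finsupp.single I 1)) := by
      ext I
      simp
    have h0 : (c.sum fun i xi ↦ c.sum fun j xj ↦ star xi *
        (Matrix.of fun p r : (F × G) × (κ ⊕ κ) => L (Finsupp.single (p.1⁻¹ * r.1, p.2, r.2) 1)) i j
        * xj) = L (sq c) := by
      rw [hLs, lc_sq]
      simp
    rw [h0]
    have hp : ∀ w : ℂ, 0 ≤ w.re → 0 ≤ (w * L (sq c)).re := by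
      intro w hw
      rw [← smul_eq_mul, ← map_smul, hL]
      exact hg2 _ (sq_pos c w hw)
    rw [Complex.nonneg_iff]
    have h1 := hp 1 (by simp)
    have h2 := hp Complex.I (by simp)
    have h3 := hp (-Complex.I) (by simp)
    simp at h1 h2 h3
    exact ⟨h1, by linarith⟩

end

lemma exists_Psi {G κ : Type} [Group G] [Fintype κ] [DecidableEq κ] (Λ : Set G) (C : ℝ)
    (hC : 0 ≤ C) (hCS : CSm Λ C) (x : G → Matrix κ κ ℂ) (hx : ∀ t ∈ Λ, IsContr 1 (x t)) :
    ∃ Ψ : FreeGroup ↥Λ × G → (κ ⊕ κ) → (κ ⊕ κ) → ℂ,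
      (Matrix.of fun p r : (FreeGroup ↥Λ × G) × (κ ⊕ κ) => Ψ (p.1⁻¹ * r.1) p.2 r.2).PosSemidef ∧
      (∀ u a b, (u ≠ 1 ∨ a ≠ b) → Ψ (u, 1) (.inl a) (.inl b) = 0) ∧
      (∀ u a b, (u ≠ 1 ∨ a ≠ b) → Ψ (u, 1) (.inr a) (.inr b) = 0) ∧
      (∀ α, Ψ (1, 1) α α = C) ∧
      (∀ u (t : ↥Λ) a b, u ≠ FreeGroup.of t → Ψ (u, t) (.inl a) (.inr b) = 0) ∧
      (∀ (t : ↥Λ) a b, Ψ (FreeGroup.of t, t) (.inl a) (.inr b) = x t a b) := by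
  classical
  obtain ⟨Ψ, h1, h2⟩ := exists_Psi_aux (F := FreeGroup ↥Λ) Λ C hC hCS
    (fun g => if h : g ∈ Λ then FreeGroup.of ⟨g, h⟩ else 1) resfin x hx
  refine ⟨fun γ α β => Ψ (γ, α, β), h2, ?_, ?_, ?_, ?_, ?_⟩
  · intro u a b h
    beta_reduce; rw [h1 _ (by simp [Allowed])]
    simp only [Psi0]
    rw [if_neg (by tauto)]
  · intro u a b h
    beta_reduce; rw [h1 _ (by simp [Allowed])]
    simp only [Psi0]
    rw [if_neg (by tauto)]
  · rintro (a | a)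
    · beta_reduce; rw [h1 _ (by simp [Allowed])]; simp [Psi0]
    · beta_reduce; rw [h1 _ (by simp [Allowed])]; simp [Psi0]
  · intro u t a b h
    beta_reduce; rw [h1 _ (by simp [Allowed])]; simp [Psi0, h]
  · intro t a b
    beta_reduce; rw [h1 _ (by simp [Allowed])]; simp [Psi0]

end SidonU

open scoped InnerProductSpace ComplexConjugate ComplexOrder

namespace SidonU

lemma bessel_const {H X : Type} [NormedAddCommGroup H] [InnerProductSpace ℂ H]
    (w : X → H) (N : ℝ) (h0 : ∀ s t, s ≠ t → ⟪w s, w t⟫_ℂ = 0) (hN : ∀ s, ‖w s‖ ^ 2 = N)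
    (x : H) (s : Finset X) (u0 : X) : ∑ u ∈ s, ‖⟪x, w u⟫_ℂ‖ ^ 2 ≤ N * ‖x‖ ^ 2 := by
  rcases s.eq_empty_or_nonempty with rfl | -
  · rw [← hN u0]; simp only [Finset.sum_empty]; positivity
  have hN0 : 0 ≤ N := by rw [← hN u0]; positivity
  rcases hN0.eq_or_lt with h | h
  · rw [← h, zero_mul]
    refine (Finset.sum_eq_zero fun u _ => ?_).le
    have : w u = 0 := by
      have := hN u
      rw [← h] at this
      simpa using this
    simp [this]
  · have hs : 0 < Real.sqrt N := Real.sqrt_pos.2 h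
    have hss : Real.sqrt N ^ 2 = N := Real.sq_sqrt hN0
    have hw : ∀ u, ‖w u‖ = Real.sqrt N := fun u => by
      rw [← hN u, Real.sqrt_sq (norm_nonneg _)]
    have ho : Orthonormal ℂ (fun u => (((Real.sqrt N)⁻¹ : ℝ) : ℂ) • w u) := by
      constructor
      · intro u
        rw [norm_smul, hw, Complex.norm_real, Real.norm_of_nonneg (by positivity)]
        field_simp
      · intro u v huv
        simp only [inner_smul_left, inner_smul_right, h0 u v huv, mul_zero]
    have := ho.sum_inner_products_le x (s := s)
    have e : ∀ u, ‖⟪(((Real.sqrt N)⁻¹ : ℝ) : ℂ) • w u, x⟫_ℂ‖ ^ 2 = N⁻¹ * ‖⟪x, w u⟫_ℂ‖ ^ 2 := by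
      intro u
      rw [inner_smul_left, norm_mul, norm_inner_symm, Complex.conj_ofReal, Complex.norm_real,
        mul_pow, Real.norm_of_nonneg (by positivity), inv_pow, hss]
    rw [Finset.sum_congr rfl fun u _ => e u, ← Finset.mul_sum] at this
    rwa [inv_mul_le_iff₀ h] at this

section
variable {F G κ : Type} [Group F] [Group G] [Fintype κ]

lemma bessel_Psi (C : ℝ)
    (Ψ : F × G → (κ ⊕ κ) → (κ ⊕ κ) → ℂ)
    (hP : (Matrix.of fun p r : (F × G) × (κ ⊕ κ) => Ψ (p.1⁻¹ * r.1) p.2 r.2).PosSemidef)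
    (h1 : ∀ u a b, (u ≠ 1 ∨ a ≠ b) → Ψ (u, 1) (.inl a) (.inl b) = 0)
    (h2 : ∀ u a b, (u ≠ 1 ∨ a ≠ b) → Ψ (u, 1) (.inr a) (.inr b) = 0)
    (h3 : ∀ α, Ψ (1, 1) α α = C) (g : G) (v w : κ → ℂ) (s : Finset F) :
    ∑ u ∈ s, ‖∑ a, ∑ b, conj (v a) * Ψ (u, g) (.inl a) (.inr b) * w b‖ ^ 2 ≤
      C ^ 2 * (∑ a, ‖v a‖ ^ 2) * (∑ a, ‖w a‖ ^ 2) := by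
  classical
  obtain ⟨H, _, _, _, e, he, -⟩ := psd_gns _ hP
  replace he : ∀ x y : (F × G) × (κ ⊕ κ), ⟪e x, e y⟫_ℂ = Ψ (x.1⁻¹ * y.1) x.2 y.2 := he
  let X : H := ∑ a, v a • e ((1, 1), .inl a)
  let Y : F → H := fun u => ∑ b, w b • e ((u, g), .inr b)
  have hXY : ∀ u, ⟪X, Y u⟫_ℂ = ∑ a, ∑ b, conj (v a) * Ψ (u, g) (.inl a) (.inr b) * w b := by
    intro u
    simp only [X, Y, sum_inner, inner_sum, inner_smul_left, inner_smul_right, he, Finset.mul_sum]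
    rw [Finset.sum_comm]
    refine Finset.sum_congr rfl fun a _ => Finset.sum_congr rfl fun b _ => ?_
    simp
    ring
  have hXX : ‖X‖ ^ 2 = C * ∑ a, ‖v a‖ ^ 2 := by
    have : ((‖X‖ ^ 2 : ℝ) : ℂ) = ((C * ∑ a, ‖v a‖ ^ 2 : ℝ) : ℂ) := by
      push_cast
      rw [← Complex.coe_algebraMap, ← inner_self_eq_norm_sq_to_K (𝕜 := ℂ)]
      simp only [X, sum_inner, inner_sum, inner_smul_left, inner_smul_right, he]
      rw [Finset.mul_sum]
      refine Finset.sum_congr rfl fun a _ => ?_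
      rw [Finset.sum_eq_single a]
      · simp [h3, ← Complex.conj_mul']; ring
      · intro b _ hb
        simp [h1 1 _ _ (Or.inr hb)]
      · simp
    exact_mod_cast this
  have hYY : ∀ u u', ⟪Y u, Y u'⟫_ℂ = if u = u' then ((C * ∑ a, ‖w a‖ ^ 2 : ℝ) : ℂ) else 0 := by
    intro u u'
    simp only [Y, sum_inner, inner_sum, inner_smul_left, inner_smul_right, he]
    split_ifs with h
    · subst h
      push_cast
      rw [Finset.mul_sum]
      refine Finset.sum_congr rfl fun a _ => ?_
      rw [Finset.sum_eq_single a]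
      · simp [h3, ← Complex.conj_mul']; ring
      · intro b _ hb
        simp [h2 1 _ _ (Or.inr hb)]
      · simp
    · refine Finset.sum_eq_zero fun a _ => mul_eq_zero_of_right _ (Finset.sum_eq_zero fun b _ => ?_)
      have h4 : u⁻¹ * u' ≠ 1 := fun h' => h (inv_mul_eq_one.1 h')
      have h5 : u'⁻¹ * u ≠ 1 := fun h' => h (inv_mul_eq_one.1 h').symm
      simp [h2 _ _ _ (Or.inl h4)]
  have hY2 : ∀ u, ‖Y u‖ ^ 2 = C * ∑ a, ‖w a‖ ^ 2 := by
    intro u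
    have : ((‖Y u‖ ^ 2 : ℝ) : ℂ) = ((C * ∑ a, ‖w a‖ ^ 2 : ℝ) : ℂ) := by
      rw [Complex.ofReal_pow, ← Complex.coe_algebraMap, ← inner_self_eq_norm_sq_to_K (𝕜 := ℂ), hYY, if_pos rfl]
      rfl
    exact_mod_cast this
  have := bessel_const Y _ (fun u u' h => by rw [hYY, if_neg h]) hY2 X s 1
  simp only [hXY, hXX] at this
  linarith


lemma psd_f {ι₁ ι₂ ι : Type} (Ψ₁ : F × G → ι₁ → ι₁ → ℂ) (Ψ₂ : F × G → ι₂ → ι₂ → ℂ)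
    (k₁ : ι → ι₁) (k₂ : ι → ι₂)
    (hP₁ : (Matrix.of fun p r : (F × G) × ι₁ => Ψ₁ (p.1⁻¹ * r.1) p.2 r.2).PosSemidef)
    (hP₂ : (Matrix.of fun p r : (F × G) × ι₂ => Ψ₂ (p.1⁻¹ * r.1) p.2 r.2).PosSemidef)
    (hd₁ : ∀ i u, u ≠ 1 → Ψ₁ (u, 1) i i = 0) (hd₂ : ∀ i u, u ≠ 1 → Ψ₂ (u, 1) i i = 0) :
    (Matrix.of fun p r : G × ι => ∑' u, Ψ₁ (u, p.1⁻¹ * r.1) (k₁ p.2) (k₁ r.2) *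
      Ψ₂ (u, p.1⁻¹ * r.1) (k₂ p.2) (k₂ r.2)).PosSemidef := by
  classical
  apply herm_of_form
  intro c
  have := schur_sum (F := F) (J := ↥c.support)
    (fun i j u => Ψ₁ (u, i.1.1⁻¹ * j.1.1) (k₁ i.1.2) (k₁ j.1.2))
    (fun i j u => Ψ₂ (u, i.1.1⁻¹ * j.1.1) (k₂ i.1.2) (k₂ j.1.2))
    (hP₁.submatrix (fun x : F × ↥c.support => ((x.1, x.2.1.1), k₁ x.2.1.2)))
    (hP₂.submatrix (fun x : F × ↥c.support => ((x.1, x.2.1.1), k₂ x.2.1.2)))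
    (fun j u hu => by simpa using hd₁ _ _ hu) (fun j u hu => by simpa using hd₂ _ _ hu)
    (fun j => c j)
  convert this using 1
  unfold Finsupp.sum
  rw [← Finset.sum_coe_sort]
  refine Finset.sum_congr rfl fun i _ => ?_
  beta_reduce
  exact (Finset.sum_coe_sort c.support (fun j : G × ι => conj (c i) * (∑' u,
    Ψ₁ (u, i.1.1⁻¹ * j.1) (k₁ i.1.2) (k₁ j.2) *
      Ψ₂ (u, i.1.1⁻¹ * j.1) (k₂ i.1.2) (k₂ j.2)) * c j)).symm

lemma re_hasSum_contr {X : Type} (coef : X → ℂ) (q : ℝ) (hq0 : 0 ≤ q) (hq : ∀ u, ‖coef u‖ ≤ q)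
    (A : X → κ → κ → ℂ) (B : X → ℂ) (C : ℝ)
    (hA : ∀ (v w : κ → ℂ) (s : Finset X), ∑ u ∈ s, ‖∑ a, ∑ b, conj (v a) * A u a b * w b‖ ^ 2 ≤
      C ^ 2 * (∑ a, ‖v a‖ ^ 2) * (∑ a, ‖w a‖ ^ 2))
    (hB : ∀ s : Finset X, ∑ u ∈ s, ‖B u‖ ^ 2 ≤ C ^ 2) :
    IsContr (q * C ^ 2) (Matrix.of fun a b => ∑' u, coef u * A u a b * B u) := by
  classical
  have hBs : Summable fun u => ‖B u‖ ^ 2 :=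
    summable_of_sum_le (fun u => sq_nonneg _) hB
  have hAs : ∀ a b, Summable fun u => ‖A u a b‖ ^ 2 := by
    intro a b
    refine summable_of_sum_le (c := C ^ 2) (fun u => sq_nonneg _) fun s => ?_
    have := hA (fun i => if i = a then 1 else 0) (fun i => if i = b then 1 else 0) s
    simpa [apply_ite, ite_pow] using this
  have hS : ∀ a b, Summable fun u => coef u * A u a b * B u := by
    intro a b
    refine Summable.of_norm_bounded (g := fun u => q * (‖A u a b‖ ^ 2 + ‖B u‖ ^ 2))
      (((hAs a b).add hBs).mul_left q) fun u => ?_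
    rw [norm_mul, norm_mul, mul_assoc]
    refine mul_le_mul (hq u) ?_ (by positivity) hq0
    nlinarith [sq_nonneg (‖A u a b‖ - ‖B u‖), sq_nonneg (‖A u a b‖), sq_nonneg (‖B u‖)]
  intro v w
  have hs : HasSum (fun u => (∑ a, ∑ b, conj (v a) * (coef u * A u a b * B u) * w b).re)
      (∑ a, ∑ b, conj (v a) * (∑' u, coef u * A u a b * B u) * w b).re := by
    refine Complex.hasSum_re ?_
    refine hasSum_sum fun a _ => hasSum_sum fun b _ => ?_
    exact ((hS a b).hasSum.mul_left _).mul_right _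
  refine hasSum_le_of_sum_le hs fun s => ?_
  have h1 : ∑ u ∈ s, (∑ a, ∑ b, conj (v a) * (coef u * A u a b * B u) * w b).re ≤
      q * ∑ u ∈ s, ‖∑ a, ∑ b, conj (v a) * A u a b * w b‖ * ‖B u‖ := by
    rw [Finset.mul_sum]
    refine Finset.sum_le_sum fun u _ => (Complex.re_le_norm _).trans ?_
    have e : ∑ a, ∑ b, conj (v a) * (coef u * A u a b * B u) * w b =
        coef u * ((∑ a, ∑ b, conj (v a) * A u a b * w b) * B u) := by
      simp only [Finset.mul_sum, Finset.sum_mul]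
      refine Finset.sum_congr rfl fun a _ => Finset.sum_congr rfl fun b _ => ?_
      ring
    rw [e, norm_mul, norm_mul]
    exact mul_le_mul_of_nonneg_right (hq u) (by positivity)
  refine h1.trans ?_
  rw [mul_div_assoc, mul_assoc]
  refine mul_le_mul_of_nonneg_left ?_ hq0
  have h2 := Finset.sum_mul_sq_le_sq_mul_sq s
    (fun u => ‖∑ a, ∑ b, conj (v a) * A u a b * w b‖) (fun u => ‖B u‖)
  set V := ∑ a, ‖v a‖ ^ 2 with hV
  set W := ∑ a, ‖w a‖ ^ 2 with hW
  have hV0 : 0 ≤ V := Finset.sum_nonneg fun _ _ => sq_nonneg _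
  have hW0 : 0 ≤ W := Finset.sum_nonneg fun _ _ => sq_nonneg _
  have h3 := mul_le_mul (hA v w s) (hB s) (Finset.sum_nonneg fun _ _ => sq_nonneg _)
    (by positivity)
  refine abs_le_of_sq_le_sq' ((h2.trans h3).trans ?_) (by positivity) |>.2
  have : 0 ≤ C ^ 4 * (V - W) ^ 2 := by positivity
  nlinarith

end

lemma grp_aux {G : Type} [Group G] (a b c d : G) : a⁻¹ * b = c⁻¹ * d ↔ c * a⁻¹ = d * b⁻¹ := by
  constructor
  · intro h
    have := congrArg (fun z => c * z * b⁻¹) h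
    simpa [mul_assoc] using this
  · intro h
    have := congrArg (fun z => c⁻¹ * z * b) h
    simpa [mul_assoc] using this

lemma exists_f {G κ : Type} [Group G] [Fintype κ] [DecidableEq κ] (Λ : Set G) (C : ℝ)
    (hC : 0 ≤ C) (hCS : CSm Λ C) (x : G → Matrix κ κ ℂ) (hx : ∀ t ∈ Λ, IsContr 1 (x t))
    (θ : ℝ) (hθ : 0 < θ) (hθ1 : θ ≤ 1) :
    ∃ f : G → (κ ⊕ κ) → (κ ⊕ κ) → ℂ,
      (Matrix.of fun p r : G × (κ ⊕ κ) => f (p.1⁻¹ * r.1) p.2 r.2).PosSemidef ∧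
      (∀ a b, f 1 (.inl a) (.inl b) = if a = b then (C : ℂ) ^ 2 else 0) ∧
      (∀ a b, f 1 (.inr a) (.inr b) = if a = b then (C : ℂ) ^ 2 else 0) ∧
      (∀ t ∈ Λ, ∀ a b, f t (.inl a) (.inr b) = θ * x t a b) ∧
      ∀ t, t ∉ Λ → IsContr (θ ^ 2 * C ^ 2) (Matrix.of fun a b => f t (.inl a) (.inr b)) := by
  classical
  obtain ⟨Ψ, p1, p2, p3, p4, p5, p6⟩ := exists_Psi Λ C hC hCS x hx
  obtain ⟨Φ, q1, q2, q3, q4, q5, q6⟩ := exists_Psi (κ := Unit) Λ C hC hCS (fun _ => 1)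
    (fun t _ v w => by
      simp only [Finset.univ_unique, Finset.sum_singleton, PUnit.default_eq_unit, Matrix.one_apply_eq, mul_one]
      refine (Complex.re_le_norm _).trans ?_
      rw [norm_mul, RCLike.norm_conj]
      nlinarith [sq_nonneg (‖v ()‖ - ‖w ()‖)])
  let p : FreeGroup ↥Λ →* G := FreeGroup.lift (fun t => (t : G))
  let deg : FreeGroup ↥Λ →* Multiplicative ℤ := FreeGroup.lift (fun _ => Multiplicative.ofAdd 1)
  let lev : κ ⊕ κ → Multiplicative ℤ := Sum.elim (fun _ => 1) (fun _ => Multiplicative.ofAdd 1)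
  let k2 : κ ⊕ κ → Unit ⊕ Unit := Sum.map (fun _ => ()) (fun _ => ())
  let co : FreeGroup ↥Λ × G → (κ ⊕ κ) → (κ ⊕ κ) → ℂ := fun γ α β =>
    ((θ ^ γ.1.norm : ℝ) : ℂ) * (if p γ.1 = γ.2 ∧ deg γ.1 = (lev α)⁻¹ * lev β then 1 else 0)
  let Ψ1 : FreeGroup ↥Λ × G → (κ ⊕ κ) → (κ ⊕ κ) → ℂ := fun γ α β => co γ α β * Ψ γ α β
  have hco : (Matrix.of fun y r : (FreeGroup ↥Λ × G) × (κ ⊕ κ) =>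
      co (y.1⁻¹ * r.1) y.2 r.2).PosSemidef := by
    have e1 := (psd_haagerup (α := ↥Λ) θ hθ hθ1).submatrix
      (fun y : (FreeGroup ↥Λ × G) × (κ ⊕ κ) => y.1.1)
    have e2 := psd_eq (fun y : (FreeGroup ↥Λ × G) × (κ ⊕ κ) =>
      (y.1.2 * (p y.1.1)⁻¹, lev y.2 * (deg y.1.1)⁻¹))
    convert psd_mul e1 e2 using 1
    ext y r
    simp only [co, Matrix.of_apply, Matrix.submatrix_apply, Prod.mk.injEq]
    congr 1
    refine if_congr (and_congr ?_ ?_) rfl rfl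
    · simp only [Prod.fst_mul, Prod.fst_inv, Prod.snd_mul, Prod.snd_inv, map_mul, map_inv]
      exact grp_aux _ _ _ _
    · simp only [Prod.fst_mul, Prod.fst_inv, map_mul, map_inv]
      exact grp_aux _ _ _ _
  have hΨ1 : (Matrix.of fun y r : (FreeGroup ↥Λ × G) × (κ ⊕ κ) =>
      Ψ1 (y.1⁻¹ * r.1) y.2 r.2).PosSemidef := psd_mul hco p1
  have hd1 : ∀ (i : κ ⊕ κ) (u : FreeGroup ↥Λ), u ≠ 1 → Ψ1 (u, 1) i i = 0 := by
    rintro (a | a) u hu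
    · simp only [Ψ1]; rw [p2 _ _ _ (Or.inl hu), mul_zero]
    · simp only [Ψ1]; rw [p3 _ _ _ (Or.inl hu), mul_zero]
  have hd2 : ∀ (i : Unit ⊕ Unit) (u : FreeGroup ↥Λ), u ≠ 1 → Φ (u, 1) i i = 0 := by
    rintro (a | a) u hu
    · exact q2 _ _ _ (Or.inl hu)
    · exact q3 _ _ _ (Or.inl hu)
  refine ⟨fun g α β => ∑' u, Ψ1 (u, g) α β * Φ (u, g) (k2 α) (k2 β),
    psd_f Ψ1 Φ id k2 hΨ1 q1 hd1 hd2, ?_, ?_, ?_, ?_⟩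
  · intro a b
    beta_reduce
    rw [tsum_eq_single 1]
    · by_cases h : a = b
      · subst h
        simp [Ψ1, co, p4, q4, k2, pow_two]
      · simp [Ψ1, p2 1 a b (Or.inr h), h]
    · intro u hu
      simp only [Ψ1]; rw [p2 _ _ _ (Or.inl hu), mul_zero, zero_mul]
  · intro a b
    beta_reduce
    rw [tsum_eq_single 1]
    · by_cases h : a = b
      · subst h
        simp [Ψ1, co, p4, q4, k2, pow_two]
      · simp [Ψ1, p3 1 a b (Or.inr h), h]
    · intro u hu
      simp only [Ψ1]; rw [p3 _ _ _ (Or.inl hu), mul_zero, zero_mul]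
  · intro t ht a b
    beta_reduce
    rw [tsum_eq_single (FreeGroup.of ⟨t, ht⟩)]
    · have e1 := p6 ⟨t, ht⟩ a b
      have e2 := q6 ⟨t, ht⟩ () ()
      simp only at e1 e2
      simp [Ψ1, co, e1, e2, k2, p, deg, lev]
    · intro u hu
      have := p5 u ⟨t, ht⟩ a b hu
      simp only at this
      simp only [Ψ1]; rw [this, mul_zero, zero_mul]
  · intro t ht
    refine re_hasSum_contr (fun u => ((θ ^ u.norm : ℝ) : ℂ) *
      (if p u = t ∧ deg u = 1⁻¹ * Multiplicative.ofAdd 1 then 1 else 0)) (θ ^ 2) (by positivity) ?_ 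
      (fun u a b => Ψ (u, t) (.inl a) (.inr b)) (fun u => Φ (u, t) (.inl ()) (.inr ())) C ?_ ?_
    · intro u
      split_ifs with h
      · have h2 : 2 ≤ u.norm := by
          refine norm_ge_two deg (fun a => by simp [deg]) u (by simpa using h.2) ?_
          rintro a rfl
          apply ht
          rw [← h.1]
          simp [p]
        rw [mul_one, Complex.norm_real, Real.norm_of_nonneg (by positivity)]
        exact pow_le_pow_of_le_one hθ.le hθ1 h2
      · simp; positivity
    · exact fun v w s => bessel_Psi C Ψ p1 p2 p3 p4 t v w s
    · intro s
      have := bessel_Psi C Φ q1 q2 q3 q4 t (fun _ => 1) (fun _ => 1) s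
      simpa using this

end SidonU

open scoped InnerProductSpace ComplexConjugate ComplexOrder

namespace SidonU

lemma isContr_zero {m : Type} [Fintype m] (c : ℝ) (hc : 0 ≤ c) :
    IsContr c (0 : Matrix m m ℂ) := by
  intro v w
  simp only [Matrix.zero_apply, mul_zero, zero_mul, Finset.sum_const_zero, Complex.zero_re]
  exact mul_nonneg (by positivity) (add_nonneg (Finset.sum_nonneg fun _ _ => sq_nonneg _)
    (Finset.sum_nonneg fun _ _ => sq_nonneg _))

lemma CSm_mono {G : Type} [Group G] (Λ Λ' : Set G) (C : ℝ) (h : CSm Λ C) (hs : Λ' ⊆ Λ) :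
    CSm Λ' C := by
  classical
  intro n _ A hA D hD hR m _ y hy ξ η
  rw [mform_congr A y (fun t => if t ∈ Λ' then y t else 0) (by
    intro t ht
    rw [if_pos]
    by_contra h'
    exact ht (hA t h'))]
  refine h n A (fun t ht => hA t fun h' => ht (hs h')) D hD hR m _ ?_ ξ η
  intro t _
  split_ifs with h'
  · exact hy t h'
  · exact isContr_zero 1 zero_le_one

lemma interp_of_CSm {G : Type} [Group G] (Λ : Set G) (C : ℝ) (hC : 0 ≤ C) (h : CSm Λ C)
    (ε : ℝ) (hε₀ : 0 < ε) (hε₁ : ε < 1) : Interp Λ (C ^ 4 / ε) ε := by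
  classical
  intro κ _ x hx
  rcases Λ.eq_empty_or_nonempty with hΛ | ⟨t0, ht0⟩
  · refine ⟨fun _ => 0, by simp [hΛ], fun t _ => isContr_zero ε hε₀.le, ?_⟩
    intro n _ A D hD hR ξ η
    have : mform A (fun _ => (0 : Matrix κ κ ℂ)) ξ η = 0 := by simp [mform]
    rw [this, Complex.zero_re]
    refine mul_nonneg (by positivity) ?_
    exact add_nonneg (Finset.sum_nonneg fun _ _ => Finset.sum_nonneg fun _ _ => sq_nonneg _)
      (Finset.sum_nonneg fun _ _ => Finset.sum_nonneg fun _ _ => sq_nonneg _)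
  have hC1 : 1 ≤ C := CSm_one_le Λ C h t0 ht0
  have hC2 : 1 ≤ C ^ 2 := one_le_pow₀ hC1
  have hCp : 0 < C := by linarith
  set θ : ℝ := ε / C ^ 2 with hθ
  have hθ0 : 0 < θ := by positivity
  have hθ1 : θ ≤ 1 := by
    rw [hθ, div_le_one (by positivity)]
    linarith
  obtain ⟨f, f1, f2, f3, f4, f5⟩ := exists_f Λ C hC h x hx θ hθ0 hθ1
  refine ⟨fun t => ((θ⁻¹ : ℝ) : ℂ) • Matrix.of fun a b => f t (.inl a) (.inr b), ?_, ?_, ?_⟩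
  · intro t ht
    ext a b
    have : (θ : ℂ) ≠ 0 := by exact_mod_cast hθ0.ne'
    simp [f4 t ht, this]
  · intro t ht
    have := (f5 t ht).smul θ⁻¹ (by positivity)
    convert this using 1
    rw [hθ]; field_simp
  · intro n _ A D hD hR ξ η
    rw [mform_smul, Complex.re_ofReal_mul]
    obtain ⟨H, _, _, _, e, π, he, hπ⟩ := gns_rep (Γ := G) (X := G × (κ ⊕ κ))
      (fun g y => (g * y.1, y.2)) (by simp) (by intros; simp [mul_assoc])
      (fun p r => f (p.1⁻¹ * r.1) p.2 r.2) f1 (by intros; simp [mul_assoc])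
    have key := hR H π (fun i => ∑ a, ξ i a • e (1, .inl a)) (fun j => ∑ b, η j b • e (1, .inr b))
    have e1 : opform A (fun t => (π t : H →L[ℂ] H)) (fun i => ∑ a, ξ i a • e (1, .inl a))
        (fun j => ∑ b, η j b • e (1, .inr b)) =
        mform A (fun t => Matrix.of fun a b => f t (.inl a) (.inr b)) ξ η := by
      unfold opform mform
      refine Finsupp.sum_congr fun t _ => ?_
      refine Finset.sum_congr rfl fun i _ => Finset.sum_congr rfl fun j _ => ?_
      congr 1
      simp only [map_sum, map_smul, hπ, sum_inner, inner_sum, inner_smul_left, inner_smul_right,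
        he, Finset.mul_sum]
      rw [Finset.sum_comm]
      refine Finset.sum_congr rfl fun a _ => Finset.sum_congr rfl fun b _ => ?_
      simp
      ring
    have nrm : ∀ (k : κ → κ ⊕ κ), (∀ a b, f 1 (k a) (k b) = if a = b then (C : ℂ) ^ 2 else 0) →
        ∀ v : κ → ℂ, ‖∑ a, v a • e (1, k a)‖ ^ 2 = C ^ 2 * ∑ a, ‖v a‖ ^ 2 := by
      intro k hk v
      have : ((‖∑ a, v a • e (1, k a)‖ ^ 2 : ℝ) : ℂ) = ((C ^ 2 * ∑ a, ‖v a‖ ^ 2 : ℝ) : ℂ) := by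
        push_cast
        rw [← Complex.coe_algebraMap, ← inner_self_eq_norm_sq_to_K (𝕜 := ℂ)]
        simp only [sum_inner, inner_sum, inner_smul_left, inner_smul_right, he]
        rw [Finset.mul_sum]
        refine Finset.sum_congr rfl fun a _ => ?_
        rw [Finset.sum_eq_single a]
        · simp [hk, ← Complex.conj_mul']; ring
        · intro b _ hb
          simp [hk, hb]
        · simp
      exact_mod_cast this
    rw [e1] at key
    simp only [nrm _ f2, nrm _ f3] at key
    rw [← Finset.mul_sum, ← Finset.mul_sum] at key
    have := mul_le_mul_of_nonneg_left key (inv_nonneg.2 hθ0.le)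
    refine this.trans (le_of_eq ?_)
    rw [hθ]
    field_simp

end SidonU

theorem completelySidon_union {G : Type} [Group G] (Λ₁ Λ₂ : Set G) (C₁ C₂ : ℝ)
    (h₁ : IsCompletelySidon Λ₁ C₁) (h₂ : IsCompletelySidon Λ₂ C₂)
    (ε : ℝ) (hε₀ : 0 < ε) (hε₁ : ε < 1) :
    IsCompletelySidon (Λ₁ ∪ Λ₂) ((C₁ ^ 4 + C₂ ^ 4) / (ε * (1 - ε))) := by
  have hC₁ := SidonU.CS_nonneg Λ₁ C₁ h₁
  have hC₂ := SidonU.CS_nonneg Λ₂ C₂ h₂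
  have i₁ := SidonU.interp_of_CSm Λ₁ C₁ hC₁ (SidonU.CSm_of_CS Λ₁ C₁ h₁ hC₁) ε hε₀ hε₁
  have i₂ := SidonU.interp_of_CSm (Λ₂ \ Λ₁) C₂ hC₂
    (SidonU.CSm_mono Λ₂ _ C₂ (SidonU.CSm_of_CS Λ₂ C₂ h₂ hC₂) Set.sdiff_subset) ε hε₀ hε₁
  have h := SidonU.CSm_of_Interp Λ₁ Λ₂ _ _ ε hε₀ hε₁ i₁ i₂
  have hε : 0 < 1 - ε := by linarith
  have e : (C₁ ^ 4 / ε + C₂ ^ 4 / ε) / (1 - ε) = (C₁ ^ 4 + C₂ ^ 4) / (ε * (1 - ε)) := by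
    field_simp
  rw [e] at h
  exact SidonU.CS_of_CSm _ _ h (by positivity)
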